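/- arXiv:1108.4840 — 4 statements merged into one kernel-verified Lean document; each statement's English description precedes it below -/
import Mathlib

section
/- Let p be a prime with p ≡ 1, 9, 11, 13, 19, or 37 (mod 40), and set S = ∑_{k=0}^{⌊p/4⌋} C(4k,2k)/(−144)^k, with congruences interpreted in ℤ/pℤ. (i) If p ≡ 1 or 9 (mod 40) and p = x² + 10y² with x, y ∈ ℤ, then y is even and S ≡ (−1)^{⌊p/3⌋ + y/2} (mod p). (ii) If p ≡ 11 or 19 (mod 40) and p = x² + 10y² with x, y ∈ ℤ and 4 | x − y, then S ≡ (−1)^{⌊p/3⌋}·(y/x) (mod p). (iii) If p ≡ 13 or 37 (mod 40) and p = 5x² + 2y² with x, y ∈ ℤ, then y is even and S ≡ (−1)^{⌊p/3⌋ + y/2} (mod p). -/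
section

open Finset
open scoped NumberTheorySymbols

theorem natCast_ne_zero_of_prime_ne {K : Type*} [Field K] {p q : ℕ} [Fact p.Prime] [CharP K p]
    (hq : q.Prime) (hpq : p ≠ q) : (q : K) ≠ 0 := fun h ↦
  hpq ((Nat.prime_dvd_prime_iff_eq Fact.out hq).1 ((CharP.cast_eq_zero_iff K p q).1 h))

theorem centralBinom_eq_choose_mul {k : Type*} [Field k] {p : ℕ} [Fact p.Prime] [CharP k p]
    {m : ℕ} (hm : 2 * m + 1 = p) {n : ℕ} (hn : n ≤ m) :
    (n.centralBinom : k) = m.choose n * (-4) ^ n := by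
  have hp : (2 * m + 1 : k) = 0 := by
    have := CharP.cast_eq_zero k p
    rw [← hm] at this; exact_mod_cast this
  induction n with
  | zero => simp
  | succ n ih =>
    have h0 : ((n + 1 : ℕ) : k) ≠ 0 := by
      rw [Ne, CharP.cast_eq_zero_iff k p]
      exact Nat.not_dvd_of_pos_of_lt (by omega) (by omega)
    have h1 := congrArg (Nat.cast (R := k)) (Nat.succ_mul_centralBinom_succ n)
    have h2 := congrArg (Nat.cast (R := k)) (Nat.choose_succ_right_eq m n)
    rw [Nat.cast_mul, Nat.cast_mul, Nat.cast_sub (by omega)] at h2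
    push_cast at h1 h2 h0
    rw [ih (by omega)] at h1
    refine mul_left_cancel₀ h0 ?_
    rw [h1, pow_succ]
    linear_combination 4 * (-4) ^ n * h2 + 2 * (m.choose n * (-4) ^ n) * hp

theorem one_add_pow_add_one_sub_pow {R : Type*} [CommRing R] (u : R) (m : ℕ) :
    (1 + u) ^ m + (1 - u) ^ m =
      2 * ∑ k ∈ range (m / 2 + 1), (m.choose (2 * k) : R) * (u ^ 2) ^ k := by
  have expand (v : R) :
      (1 + v) ^ m = ∑ j ∈ range (2 * (m / 2 + 1)), (m.choose j : R) * v ^ j := by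
    rw [add_comm, add_pow]
    refine sum_subset_zero_on_sdiff (range_subset_range.2 (by omega)) (fun j hj ↦ ?_)
      (fun j _ ↦ by ring)
    simp only [mem_sdiff, mem_range] at hj
    rw [Nat.choose_eq_zero_of_lt (by omega)]; simp
  have pair (g : ℕ → R) (n : ℕ) :
      ∑ j ∈ range (2 * n), g j = ∑ k ∈ range n, (g (2 * k) + g (2 * k + 1)) := by
    induction n with
    | zero => simp
    | succ n ih => rw [Nat.mul_succ, sum_range_succ, sum_range_succ, ih, sum_range_succ]; ring
  rw [expand, sub_eq_add_neg, expand, ← sum_add_distrib, pair, mul_sum]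
  refine sum_congr rfl fun k _ ↦ ?_
  rw [Odd.neg_pow ⟨k, rfl⟩, Even.neg_pow ⟨k, by ring⟩, pow_mul]
  ring

theorem two_mul_three_pow_mul_sum {k : Type*} [Field k] {p : ℕ} [Fact p.Prime] [CharP k p]
    {m : ℕ} (hm : 2 * m + 1 = p) (hp3 : p ≠ 3) {I : k} (hI : I ^ 2 = -1) :
    2 * 3 ^ m * ∑ j ∈ range (p / 4 + 1), (Nat.choose (4 * j) (2 * j) : k) / (-144) ^ j =
      (3 + I) ^ m + (3 - I) ^ m := by
  have h3 : (3 : k) ≠ 0 := mod_cast natCast_ne_zero_of_prime_ne (K := k) Nat.prime_three hp3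
  have h2 : (2 : k) ≠ 0 :=
    mod_cast natCast_ne_zero_of_prime_ne (K := k) Nat.prime_two (show p ≠ 2 by omega)
  have e1 : 3 + I = 3 * (1 + I / 3) := by field_simp
  have e2 : 3 - I = 3 * (1 - I / 3) := by field_simp
  rw [e1, e2, mul_pow, mul_pow, ← mul_add, one_add_pow_add_one_sub_pow,
    show p / 4 = m / 2 by omega, mul_assoc, mul_left_comm]
  congr 2
  refine sum_congr rfl fun j hj ↦ ?_
  rw [mem_range] at hj
  have := centralBinom_eq_choose_mul (k := k) hm (n := 2 * j) (by omega)
  rw [Nat.centralBinom, show 2 * (2 * j) = 4 * j by ring] at this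
  rw [this, div_pow, hI, mul_div_assoc, pow_mul, ← div_pow]
  congr 2
  rw [show (-144 : k) = -(2 ^ 4 * 3 ^ 2) by norm_num, show (-4 : k) ^ 2 = 2 ^ 4 by norm_num]
  field_simp

/-- `Ψ` behaves like the biquadratic residue symbol `n ↦ (n / z)₄` on rational integers. -/
structure IsQuarticSymbol (z : GaussianInt) (Ψ : ℤ →* GaussianInt) : Prop where
  periodic : ∀ m n : ℤ, z.norm ∣ m - n → Ψ m = Ψ n
  sq : ∀ n : ℤ, Ψ n ^ 2 = (J(n | z.norm.natAbs) : ℤ)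
  recip_one : ∀ (p : ℕ) [Fact p.Prime] (k : Type) [Field k] [CharP k p] (f : GaussianInt →+* k),
    p % 4 = 1 → ¬ (p : ℤ) ∣ z.norm →
      f (star z) ^ (p / 4) * f (Ψ p) = f z ^ (p / 4)
  recip_three : ∀ (p : ℕ) [Fact p.Prime] (k : Type) [Field k] [CharP k p] (f : GaussianInt →+* k),
    p % 4 = 3 → ¬ (p : ℤ) ∣ z.norm →
      f (star z) ^ (p / 4 + 1) = (J(2 | z.norm.natAbs) : ℤ) * f (Ψ p) * f z ^ (p / 4 + 1)

namespace IsQuarticSymbol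

theorem one : IsQuarticSymbol 1 1 where
  periodic := by simp
  sq := by simp
  recip_one := by simp
  recip_three := by simp

theorem neg {z : GaussianInt} {Ψ : ℤ →* GaussianInt} (h : IsQuarticSymbol z Ψ) :
    IsQuarticSymbol (-z) Ψ where
  periodic := by simpa using h.periodic
  sq := by simpa using h.sq
  recip_one p _ k _ _ f h1 h2 := by
    have := h.recip_one p k f h1 (by simpa using h2)
    rw [star_neg, map_neg, map_neg, neg_pow, neg_pow (f z), ← this]; ring
  recip_three p _ k _ _ f h1 h2 := by
    have := h.recip_three p k f h1 (by simpa using h2)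
    rw [star_neg, map_neg, map_neg, neg_pow, neg_pow (f z), this, Zsqrtd.norm_neg]; ring

theorem mul {z w : GaussianInt} {Ψ Φ : ℤ →* GaussianInt} (hz : z ≠ 0) (hw : w ≠ 0)
    (h : IsQuarticSymbol z Ψ) (h' : IsQuarticSymbol w Φ) : IsQuarticSymbol (z * w) (Ψ * Φ) := by
  have hz' : z.norm.natAbs ≠ 0 := by simpa [GaussianInt.norm_eq_zero] using hz
  have hw' : w.norm.natAbs ≠ 0 := by simpa [GaussianInt.norm_eq_zero] using hw
  refine ⟨fun m n hmn ↦ ?_, fun n ↦ ?_, fun p _ k _ _ f h1 h2 ↦ ?_, fun p _ k _ _ f h1 h2 ↦ ?_⟩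
  · rw [Zsqrtd.norm_mul] at hmn
    simp only [MonoidHom.mul_apply]
    rw [h.periodic m n (dvd_of_mul_right_dvd hmn), h'.periodic m n (dvd_of_mul_left_dvd hmn)]
  · rw [MonoidHom.mul_apply, mul_pow, h.sq, h'.sq, Zsqrtd.norm_mul, Int.natAbs_mul,
      jacobiSym.mul_right' _ hz' hw', Int.cast_mul]
  · rw [Zsqrtd.norm_mul] at h2
    rw [map_mul, mul_pow, ← h.recip_one p k f h1 fun h ↦ h2 (h.mul_right _),
      ← h'.recip_one p k f h1 fun h ↦ h2 (h.mul_left _)]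
    simp only [star_mul, map_mul, mul_pow, MonoidHom.mul_apply]
    ring
  · rw [Zsqrtd.norm_mul] at h2
    have e1 := h.recip_three p k f h1 fun h ↦ h2 (h.mul_right _)
    have e2 := h'.recip_three p k f h1 fun h ↦ h2 (h.mul_left _)
    simp only [star_mul, map_mul, mul_pow, MonoidHom.mul_apply]
    rw [e1, e2, Zsqrtd.norm_mul, Int.natAbs_mul, jacobiSym.mul_right' _ hz' hw', Int.cast_mul]
    ring

theorem natCast {q : ℕ} [Fact q.Prime] (hq2 : q ≠ 2) :
    ∃ Ψ, IsQuarticSymbol (q : GaussianInt) Ψ := by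
  let Ψ : ℤ →* GaussianInt :=
    { toFun n := ((J(n | q) ^ 2 : ℤ) : GaussianInt)
      map_one' := by simp
      map_mul' m n := by rw [jacobiSym.mul_left, mul_pow, Int.cast_mul] }
  have hN : (q : GaussianInt).norm = q * q := Zsqrtd.norm_natCast q
  have hN' : (q : GaussianInt).norm.natAbs = q ^ 2 := by
    rw [hN, Int.natAbs_mul, Int.natAbs_natCast, _root_.sq]
  have cop {p : ℕ} [Fact p.Prime] (h : ¬ (p : ℤ) ∣ (q : GaussianInt).norm) :
      J(p | q) ^ 2 = 1 := by
    refine jacobiSym.sq_one ?_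
    rw [Int.gcd_natCast_natCast]
    refine (Nat.coprime_primes Fact.out Fact.out).2 ?_
    rintro rfl
    exact h (hN ▸ Dvd.intro _ rfl)
  refine ⟨Ψ, fun m n h ↦ ?_, fun n ↦ ?_, fun p _ k _ _ f h1 h2 ↦ ?_, fun p _ k _ _ f h1 h2 ↦ ?_⟩
  · have : J(m | q) = J(n | q) :=
      jacobiSym.mod_left' (Int.modEq_iff_dvd.2 ((Dvd.intro _ hN.symm).trans h)).symm
    exact congrArg (fun t : ℤ ↦ ((t ^ 2 : ℤ) : GaussianInt)) this
  · rw [hN', jacobiSym.pow_right]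
    have : (J(n | q) ^ 2) ^ 2 = J(n | q) ^ 2 := by
      rcases jacobiSym.trichotomy n q with h | h | h <;> rw [h] <;> norm_num
    exact (Int.cast_pow _ _).symm.trans (congrArg _ this)
  · have : Ψ p = ((1 : ℤ) : GaussianInt) := congrArg (Int.cast (R := GaussianInt)) (cop h2)
    rw [this]; simp
  · have e : Ψ p = ((1 : ℤ) : GaussianInt) := congrArg (Int.cast (R := GaussianInt)) (cop h2)
    have hq : J(2 | q) ^ 2 = 1 :=
      jacobiSym.sq_one ((Nat.coprime_primes Nat.prime_two (Fact.out : q.Prime)).2 hq2.symm)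
    rw [e, hN', jacobiSym.pow_right, hq]; simp

end IsQuarticSymbol

theorem GaussianInt.map_pow_char_of_one_mod_four {K : Type*} [Field K] {p : ℕ} [Fact p.Prime]
    [CharP K p] (hp : p % 4 = 1) (f : GaussianInt →+* K) (z : GaussianInt) : f z ^ p = f z := by
  have hI : (Zsqrtd.sqrtd : GaussianInt) ^ 4 = 1 := by decide
  have : (frobenius K p).comp f = f := by
    refine Zsqrtd.hom_ext _ _ ?_
    rw [RingHom.comp_apply, frobenius_def, ← map_pow, ← Nat.div_add_mod p 4, hp, pow_add,
      pow_mul, hI, one_pow, one_mul, pow_one]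
  exact congrArg (· z) this

theorem GaussianInt.map_pow_char_of_three_mod_four {K : Type*} [Field K] {p : ℕ} [Fact p.Prime]
    [CharP K p] (hp : p % 4 = 3) (f : GaussianInt →+* K) (z : GaussianInt) :
    f z ^ p = f (star z) := by
  have hI : (Zsqrtd.sqrtd : GaussianInt) ^ 4 = 1 := by decide
  have : (frobenius K p).comp f = f.comp (starRingEnd GaussianInt) := by
    refine Zsqrtd.hom_ext _ _ ?_
    rw [RingHom.comp_apply, RingHom.comp_apply, frobenius_def, ← map_pow, ← Nat.div_add_mod p 4,
      hp, pow_add, pow_mul, hI, one_pow, one_mul]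
    rfl
  exact congrArg (· z) this

theorem GaussianInt.isPrimitiveRoot_sqrtd : IsPrimitiveRoot (Zsqrtd.sqrtd : GaussianInt) 4 := by
  refine IsPrimitiveRoot.mk_of_lt _ (by norm_num) (by decide) fun l hl hl' ↦ ?_
  interval_cases l <;> decide

section QuarticChar

variable {q : ℕ} [Fact q.Prime] {χ : MulChar (ZMod q) GaussianInt}

theorem MulChar.norm_apply_of_pow_four (h4 : χ ^ 4 = 1) {a : ZMod q} (ha : a ≠ 0) :
    (χ a).norm = 1 := by
  have h : χ a ^ 4 = 1 := by
    rw [← MulChar.pow_apply' χ (by norm_num), h4, MulChar.one_apply ha.isUnit]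
  rw [Zsqrtd.norm_eq_one_iff' (by norm_num)]
  exact IsUnit.of_pow_eq_one h (by norm_num)

theorem MulChar.ringHomComp_star_of_pow_four (h4 : χ ^ 4 = 1) :
    χ.ringHomComp (starRingEnd GaussianInt) = χ⁻¹ := by
  rw [eq_inv_iff_mul_eq_one]
  ext1 a
  have := Zsqrtd.norm_eq_mul_conj (χ a)
  rw [MulChar.norm_apply_of_pow_four h4 a.ne_zero, Int.cast_one] at this
  rw [MulChar.mul_apply, MulChar.one_apply a.isUnit, this, mul_comm]
  rfl

theorem MulChar.sq_apply_eq_quadraticChar (h2 : χ ^ 2 ≠ 1) (h4 : χ ^ 4 = 1) (a : ZMod q) :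
    χ a ^ 2 = (quadraticChar (ZMod q) a : ℤ) := by
  rcases eq_or_ne a 0 with rfl | ha
  · simp
  have pm {b : ZMod q} (hb : b ≠ 0) : χ b ^ 2 = 1 ∨ χ b ^ 2 = -1 := by
    rw [← mul_self_eq_one_iff, ← pow_add, ← MulChar.pow_apply' χ (by norm_num), h4,
      MulChar.one_apply hb.isUnit]
  have sq_one {b : ZMod q} (hb : b ≠ 0) (h : quadraticChar (ZMod q) b = 1) : χ b ^ 2 = 1 := by
    obtain ⟨c, rfl⟩ := (quadraticChar_one_iff_isSquare hb).1 h
    rw [map_mul, ← sq, ← pow_mul, ← MulChar.pow_apply' χ (by norm_num), h4,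
      MulChar.one_apply (left_ne_zero_of_mul hb).isUnit]
  rcases quadraticChar_dichotomy ha with h | h
  · rw [h, sq_one ha h, Int.cast_one]
  obtain ⟨g, hg⟩ : ∃ g : (ZMod q)ˣ, χ g ^ 2 ≠ 1 := by
    by_contra! H
    refine h2 (MulChar.ext fun g ↦ ?_)
    rw [MulChar.pow_apply_coe, H, MulChar.one_apply g.isUnit]
  have hg' : quadraticChar (ZMod q) g = -1 :=
    (quadraticChar_dichotomy g.ne_zero).resolve_left fun H ↦ hg (sq_one g.ne_zero H)
  have := sq_one (mul_ne_zero ha g.ne_zero) (by rw [map_mul, h, hg']; rfl)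
  rw [map_mul, mul_pow, (pm g.ne_zero).resolve_left hg] at this
  rw [h, Int.cast_neg, Int.cast_one, ← this]
  ring

theorem MulChar.apply_neg_one_eq_quadraticChar_two (hq : q % 4 = 1) (h2 : χ ^ 2 ≠ 1)
    (h4 : χ ^ 4 = 1) : χ (-1) = (quadraticChar (ZMod q) 2 : ℤ) := by
  obtain ⟨j, hj⟩ := ZMod.exists_sq_eq_neg_one_iff.2 (show q % 4 ≠ 3 by omega)
  have h0 : (2 : ZMod q) ≠ 0 :=
    mod_cast natCast_ne_zero_of_prime_ne (K := ZMod q) Nat.prime_two (show q ≠ 2 by omega)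
  have h1 : (1 + j) ^ 2 = 2 * j := by linear_combination -hj
  have hj0 : j ≠ 0 := by rintro rfl; simp at hj
  have h1' : 1 + j ≠ 0 := by
    intro h
    rw [h, zero_pow two_ne_zero] at h1
    exact mul_ne_zero h0 hj0 h1.symm
  have e := quadraticChar_sq_one' h1'
  rw [h1, map_mul] at e
  rw [hj, map_mul, ← sq, sq_apply_eq_quadraticChar h2 h4]
  congr 1
  rcases quadraticChar_dichotomy h0 with h | h <;> rw [h] at e ⊢ <;> linarith

theorem star_jacobiSum_of_pow_four (h4 : χ ^ 4 = 1) :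
    star (jacobiSum χ χ) = jacobiSum χ⁻¹ χ⁻¹ := by
  rw [← MulChar.ringHomComp_star_of_pow_four h4, jacobiSum_ringHomComp]
  rfl

theorem norm_jacobiSum_of_pow_four (h2 : χ ^ 2 ≠ 1) (h4 : χ ^ 4 = 1) :
    (jacobiSum χ χ).norm = q := by
  have inj := GaussianInt.toComplex_injective
  have h1 : χ ≠ 1 := by rintro rfl; simp at h2
  have := jacobiSum_mul_jacobiSum_inv (χ := χ.ringHomComp GaussianInt.toComplex)
    (φ := χ.ringHomComp GaussianInt.toComplex)
    (by rw [ringChar.eq_zero, ZMod.ringChar_zmod_n]; exact (NeZero.ne q).symm)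
    ((MulChar.ringHomComp_ne_one_iff inj).2 h1) ((MulChar.ringHomComp_ne_one_iff inj).2 h1)
    (by rw [← MulChar.ringHomComp_mul, MulChar.ringHomComp_ne_one_iff inj, ← sq]; exact h2)
  rw [MulChar.ringHomComp_inv, jacobiSum_ringHomComp, jacobiSum_ringHomComp,
    ← star_jacobiSum_of_pow_four h4, ← map_mul, ← Zsqrtd.norm_eq_mul_conj, ZMod.card,
    map_intCast] at this
  exact_mod_cast this

theorem even_im_jacobiSum_of_pow_four (hq : q % 4 = 1) (h4 : χ ^ 4 = 1) :
    Even (jacobiSum χ χ).im := by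
  obtain ⟨z, -, hz⟩ := exists_jacobiSum_eq_neg_one_add (by norm_num : 2 < 4) h4 h4
    (by rw [ZMod.card]; omega) GaussianInt.isPrimitiveRoot_sqrtd
  have : (Zsqrtd.sqrtd - 1 : GaussianInt) ^ 2 = ⟨0, -2⟩ := by decide
  rw [hz, this]
  simp [Zsqrtd.im_mul]

theorem MulChar.apply_mul_gaussSum_pow {K : Type*} [Field K] {p : ℕ} [Fact p.Prime] [CharP K p]
    (hpq : p ≠ q) (χ : MulChar (ZMod q) K) (ψ : AddChar (ZMod q) K) :
    (χ ^ p) p * gaussSum χ ψ ^ p = gaussSum (χ ^ p) ψ := by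
  have hu : IsUnit (p : ZMod q) := by
    rw [ZMod.isUnit_iff_coprime]
    exact (Nat.coprime_primes Fact.out Fact.out).2 hpq
  rw [gaussSum_frob, AddChar.pow_mulShift, ← hu.unit_spec]
  exact gaussSum_mulShift _ ψ hu.unit

theorem MulChar.ringHomComp_mul_self_ne_one {K : Type*} [Field K] {p : ℕ} [Fact p.Prime]
    [CharP K p] (hq : q % 4 = 1) (h2 : χ ^ 2 ≠ 1) (h4 : χ ^ 4 = 1) (hp2 : p ≠ 2)
    (f : GaussianInt →+* K) : χ.ringHomComp f * χ.ringHomComp f ≠ 1 := by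
  obtain ⟨g, hg⟩ := quadraticChar_exists_neg_one (F := ZMod q)
    (by rw [ZMod.ringChar_zmod_n]; omega)
  intro h
  have h0 : g ≠ 0 := by rintro rfl; simp at hg
  have := congrArg (fun ψ : MulChar (ZMod q) K ↦ ψ g) h
  rw [MulChar.mul_apply, MulChar.ringHomComp_apply, ← map_mul, ← sq,
    MulChar.sq_apply_eq_quadraticChar h2 h4, hg, MulChar.one_apply h0.isUnit, map_intCast,
    Int.cast_neg, Int.cast_one] at this
  exact Ring.neg_one_ne_one_of_char_ne_two (by rwa [ringChar.eq K p]) this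

theorem gaussSum_pow_four {K : Type*} [Field K] {p : ℕ} [Fact p.Prime] [CharP K p]
    (hq : q % 4 = 1) (h2 : χ ^ 2 ≠ 1) (h4 : χ ^ 4 = 1) (hp2 : p ≠ 2) (f : GaussianInt →+* K)
    {ψ : AddChar (ZMod q) K} (hψ : ψ.IsPrimitive) :
    gaussSum (χ.ringHomComp f) ψ ^ 4 = f (jacobiSum χ χ) ^ 2 * q := by
  have hne := MulChar.ringHomComp_mul_self_ne_one hq h2 h4 hp2 f
  have hquad : (χ.ringHomComp f * χ.ringHomComp f).IsQuadratic := by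
    intro a
    rw [MulChar.mul_apply, MulChar.ringHomComp_apply, ← map_mul, ← sq,
      MulChar.sq_apply_eq_quadraticChar h2 h4, map_intCast]
    rcases quadraticChar_isQuadratic (ZMod q) a with h | h | h <;> rw [h] <;> simp
  have h1 : (χ.ringHomComp f * χ.ringHomComp f) (-1) = 1 := by
    rw [MulChar.mul_apply, ← map_mul]; simp
  have e := gaussSum_sq hne hquad hψ
  rw [h1, one_mul, ZMod.card] at e
  have e' := jacobiSum_mul_nontrivial hne ψ
  rw [jacobiSum_ringHomComp] at e'
  rw [show 4 = 2 * 2 by rfl, pow_mul, sq (gaussSum (χ.ringHomComp f) ψ), ← e', mul_pow, e, mul_comm]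

theorem star_jacobiSum_pow_of_one_mod_four {K : Type*} [Field K] {p : ℕ} [Fact p.Prime] [CharP K p]
    (hq : q % 4 = 1) (h2 : χ ^ 2 ≠ 1) (h4 : χ ^ 4 = 1) (hp : p % 4 = 1) (hpq : p ≠ q)
    (f : GaussianInt →+* K) {ψ : AddChar (ZMod q) K} (hψ : ψ.IsPrimitive) :
    f (star (jacobiSum χ χ)) ^ (p / 4) * f (χ p) = f (jacobiSum χ χ) ^ (p / 4) := by
  have hq0 : (q : K) ≠ 0 := natCast_ne_zero_of_prime_ne Fact.out hpq
  have hJ : f (jacobiSum χ χ) * f (star (jacobiSum χ χ)) = q := by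
    rw [← map_mul, ← Zsqrtd.norm_eq_mul_conj, norm_jacobiSum_of_pow_four h2 h4]; simp
  have hg := gaussSum_pow_four hq h2 h4 (show p ≠ 2 by omega) f hψ
  have hpow : χ ^ p = χ := by
    rw [← Nat.div_add_mod p 4, hp, pow_succ, pow_mul, h4, one_pow, one_mul]
  have hfr := MulChar.apply_mul_gaussSum_pow hpq (χ.ringHomComp f) ψ
  have hpJ := GaussianInt.map_pow_char_of_one_mod_four hp f (jacobiSum χ χ)
  rw [MulChar.ringHomComp_pow, hpow, MulChar.ringHomComp_apply] at hfr
  set g := gaussSum (χ.ringHomComp f) ψ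
  set J := f (jacobiSum χ χ)
  set J' := f (star (jacobiSum χ χ))
  set e := p / 4
  have hpe : p = 4 * e + 1 := by omega
  have hJ0 : J ≠ 0 := left_ne_zero_of_mul (hJ ▸ hq0)
  have hg0 : g ≠ 0 := by
    intro h
    rw [h, zero_pow four_ne_zero, eq_comm] at hg
    exact mul_ne_zero (pow_ne_zero 2 hJ0) hq0 hg
  rw [hpe, pow_succ, pow_mul] at hpJ hfr
  rw [← mul_assoc] at hfr
  have hJ4 : (J ^ 4) ^ e = 1 := mul_right_cancel₀ hJ0 (hpJ.trans (one_mul _).symm)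
  have hg4 := mul_right_cancel₀ hg0 (hfr.trans (one_mul _).symm)
  rw [hg, ← hJ] at hg4
  calc J' ^ e * f (χ p) = (J ^ 4) ^ e * (J' ^ e * f (χ p)) := by rw [hJ4, one_mul]
    _ = J ^ e * (f (χ p) * (J ^ 2 * (J * J')) ^ e) := by simp only [mul_pow, ← pow_mul]; ring
    _ = J ^ e := by rw [← hpe] at hg4; rw [hg4, mul_one]

theorem star_jacobiSum_pow_of_three_mod_four {K : Type*} [Field K] {p : ℕ} [Fact p.Prime]
    [CharP K p] (hq : q % 4 = 1) (h2 : χ ^ 2 ≠ 1) (h4 : χ ^ 4 = 1) (hp : p % 4 = 3) (hpq : p ≠ q)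
    (f : GaussianInt →+* K) {ψ : AddChar (ZMod q) K} (hψ : ψ.IsPrimitive) :
    f (star (jacobiSum χ χ)) ^ (p / 4 + 1) =
      f (χ (-1)) * f (χ p) * f (jacobiSum χ χ) ^ (p / 4 + 1) := by
  have hq0 : (q : K) ≠ 0 := natCast_ne_zero_of_prime_ne Fact.out hpq
  have hJ : f (jacobiSum χ χ) * f (star (jacobiSum χ χ)) = q := by
    rw [← map_mul, ← Zsqrtd.norm_eq_mul_conj, norm_jacobiSum_of_pow_four h2 h4]; simp
  have hg := gaussSum_pow_four hq h2 h4 (show p ≠ 2 by omega) f hψ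
  have hpow : χ ^ p = χ⁻¹ := by
    rw [eq_inv_iff_mul_eq_one, ← pow_succ, ← Nat.div_add_mod p 4, hp, add_assoc, pow_add, pow_mul,
      h4, one_pow, one_mul]
  have hfr := MulChar.apply_mul_gaussSum_pow hpq (χ.ringHomComp f) ψ
  have hpJ := GaussianInt.map_pow_char_of_three_mod_four hp f (jacobiSum χ χ)
  have hpu : IsUnit (p : ZMod q) := by
    rw [ZMod.isUnit_iff_coprime]
    exact (Nat.coprime_primes Fact.out Fact.out).2 hpq
  have hinv {a : ZMod q} (ha : IsUnit a) : f (χ a) * f (χ⁻¹ a) = 1 := by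
    rw [← map_mul, ← MulChar.mul_apply, mul_inv_cancel, MulChar.one_apply ha, map_one]
  have hχ1 : χ.ringHomComp f ≠ 1 := fun h ↦
    MulChar.ringHomComp_mul_self_ne_one hq h2 h4 (show p ≠ 2 by omega) f (by rw [h, one_mul])
  have hcard := gaussSum_mul_gaussSum_eq_card hχ1 hψ
  have hneg := mul_gaussSum_inv_eq_gaussSum (χ.ringHomComp f)⁻¹ ψ
  rw [MulChar.ringHomComp_inv, ZMod.card] at hcard
  rw [MulChar.ringHomComp_inv, MulChar.ringHomComp_apply] at hneg
  rw [MulChar.ringHomComp_pow, hpow, MulChar.ringHomComp_apply, ← hneg] at hfr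
  have hm1 : f (χ⁻¹ (-1)) = f (χ (-1)) := by
    have h := hinv (a := -1) isUnit_neg_one
    have h' : f (χ (-1)) * f (χ (-1)) = 1 := by rw [← map_mul, ← map_mul]; simp
    exact mul_left_cancel₀ (left_ne_zero_of_mul (h ▸ one_ne_zero)) (h.trans h'.symm)
  set g := gaussSum (χ.ringHomComp f) ψ
  set J := f (jacobiSum χ χ)
  set J' := f (star (jacobiSum χ χ))
  set e := p / 4 + 1
  have hpe : p + 1 = 4 * e := by omega
  have hgp : g ^ (p + 1) = f (χ (-1)) * f (χ p) * q := by
    rw [← hcard, ← hm1, pow_succ]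
    linear_combination g * f (χ p) * hfr - g ^ p * g * hinv hpu
  have hJp : J ^ (p + 1) = q := by rw [pow_succ, hpJ, mul_comm, hJ]
  rw [hpe, pow_mul] at hgp hJp
  refine mul_right_cancel₀ hq0 ?_
  calc J' ^ e * q = J' ^ e * (J ^ 4) ^ e := by rw [hJp]
    _ = J ^ e * (J ^ 2 * (J * J')) ^ e := by simp only [mul_pow, ← pow_mul]; ring
    _ = f (χ (-1)) * f (χ p) * J ^ e * q := by rw [hJ, ← hg, hgp]; ring

theorem IsQuarticSymbol.jacobiSum (hq : q % 4 = 1) (h2 : χ ^ 2 ≠ 1) (h4 : χ ^ 4 = 1) :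
    IsQuarticSymbol (jacobiSum χ χ)
      (χ.toMonoidHom.comp (Int.castRingHom (ZMod q) : ℤ →* ZMod q)) := by
  have hN := norm_jacobiSum_of_pow_four h2 h4
  have val (n : ℤ) : χ.toMonoidHom.comp (Int.castRingHom (ZMod q) : ℤ →* ZMod q) n = χ n := rfl
  have char_ne {p : ℕ} (h : ¬ (p : ℤ) ∣ (_root_.jacobiSum χ χ).norm) : p ≠ q := by
    rintro rfl
    exact h hN.symm.dvd
  have ringChar_ne {p : ℕ} [Fact p.Prime] (K : Type) [Field K] [CharP K p] (h : p ≠ q) :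
      ringChar K ≠ ringChar (ZMod q) := by rwa [ringChar.eq K p, ZMod.ringChar_zmod_n]
  refine ⟨fun m n h ↦ ?_, fun n ↦ ?_, fun p _ K _ _ f hp h ↦ ?_, fun p _ K _ _ f hp h ↦ ?_⟩
  · rw [hN] at h
    rw [val, val, (ZMod.intCast_eq_intCast_iff_dvd_sub n m q).2 h]
  · rw [val, MulChar.sq_apply_eq_quadraticChar h2 h4, hN, Int.natAbs_natCast,
      ← jacobiSym.legendreSym.to_jacobiSym]
    rfl
  · have hpq := char_ne h
    let ψ := AddChar.FiniteField.primitiveChar (ZMod q) K (ringChar_ne K hpq)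
    have : CharP (CyclotomicField ψ.n K) p := charP_of_injective_algebraMap' K p
    refine (algebraMap K (CyclotomicField ψ.n K)).injective ?_
    simpa [val] using star_jacobiSum_pow_of_one_mod_four hq h2 h4 hp hpq
      ((algebraMap K (CyclotomicField ψ.n K)).comp f) ψ.prim
  · have hpq := char_ne h
    let ψ := AddChar.FiniteField.primitiveChar (ZMod q) K (ringChar_ne K hpq)
    have : CharP (CyclotomicField ψ.n K) p := charP_of_injective_algebraMap' K p
    have h1 : χ (-1) = (J(2 | (_root_.jacobiSum χ χ).norm.natAbs) : ℤ) := by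
      rw [MulChar.apply_neg_one_eq_quadraticChar_two hq h2 h4, hN, Int.natAbs_natCast,
        ← jacobiSym.legendreSym.to_jacobiSym, legendreSym, Int.cast_ofNat]
    refine (algebraMap K (CyclotomicField ψ.n K)).injective ?_
    simpa [val, h1] using star_jacobiSum_pow_of_three_mod_four hq h2 h4 hp hpq
      ((algebraMap K (CyclotomicField ψ.n K)).comp f) ψ.prim

end QuarticChar

theorem GaussianInt.eq_star_of_dvd_re_mul {q : ℕ} [Fact q.Prime] {z w : GaussianInt}
    (hz : z.norm = q) (hw : w.norm = q) (hq : Odd q) (hzi : Even z.im) (hwi : Even w.im)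
    (h : (q : ℤ) ∣ (z * w).re) : z = star w ∨ z = -star w := by
  have hq0 : (q : ℤ) ≠ 0 := mod_cast (NeZero.ne q)
  obtain ⟨u, hu⟩ := h
  have hN : (z * w).re ^ 2 + (z * w).im ^ 2 = (q : ℤ) ^ 2 := by
    rw [sq (q : ℤ)]
    nth_rewrite 1 [← hz]
    rw [← hw, ← Zsqrtd.norm_mul, Zsqrtd.norm_def]
    ring
  obtain ⟨v, hv⟩ : (q : ℤ) ∣ (z * w).im := by
    refine Int.Prime.dvd_pow' (k := 2) Fact.out ⟨q - q * u ^ 2, ?_⟩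
    rw [hu] at hN
    linear_combination hN
  have hve : Even v := by
    have : Even (z * w).im := by
      rw [Zsqrtd.im_mul]
      exact (hwi.mul_left _).add (hzi.mul_right _)
    rw [hv, Int.even_mul] at this
    exact this.resolve_left (by simpa using hq)
  have huv : u ^ 2 + v ^ 2 = 1 := by
    refine mul_left_cancel₀ (pow_ne_zero 2 hq0) ?_
    rw [hu, hv] at hN
    linear_combination hN
  have hv0 : v = 0 := by
    obtain ⟨t, rfl⟩ := hve
    by_contra h
    have : 0 < t ^ 2 := sq_pos_of_ne_zero (by rintro rfl; simp at h)
    nlinarith [sq_nonneg u]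
  subst hv0
  have hw0 : w ≠ 0 := by
    rintro rfl
    exact hq0 (by simpa using hw.symm)
  have hww : star w * w = (q : ℤ) := by rw [← hw, Zsqrtd.norm_eq_mul_conj, mul_comm]
  have hzw : z * w = (u : ℤ) * (star w * w) := by
    rw [hww, ← Int.cast_mul]
    ext
    · rw [hu, Zsqrtd.re_intCast, mul_comm]
    · rw [hv, Zsqrtd.im_intCast, mul_zero]
  rcases mul_self_eq_one_iff.1 (show u * u = 1 by simpa [sq] using huv) with rfl | rfl
  · left; exact mul_right_cancel₀ hw0 (by simpa using hzw)
  · right; exact mul_right_cancel₀ hw0 (by simpa using hzw)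

/-- Elements of the same odd prime norm with even imaginary part agree up to sign and
conjugation. -/
theorem GaussianInt.eq_or_eq_of_norm_eq_prime {q : ℕ} [Fact q.Prime] {z w : GaussianInt}
    (hz : z.norm = q) (hw : w.norm = q) (hq : Odd q) (hzi : Even z.im) (hwi : Even w.im) :
    (z = w ∨ z = -w) ∨ z = star w ∨ z = -star w := by
  have h : (q : ℤ) ∣ (z * w).re * (z * star w).re := by
    refine ⟨z.re ^ 2 - w.im ^ 2, ?_⟩
    simp only [Zsqrtd.norm_def] at hz hw
    simp only [Zsqrtd.re_mul, Zsqrtd.re_star, Zsqrtd.im_star]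
    linear_combination (z.re ^ 2) * hw - w.im ^ 2 * hz
  rcases Int.Prime.dvd_mul' Fact.out h with h | h
  · exact .inr (GaussianInt.eq_star_of_dvd_re_mul hz hw hq hzi hwi h)
  · left
    simpa using GaussianInt.eq_star_of_dvd_re_mul hz (w := star w) (by rwa [Zsqrtd.norm_conj]) hq
      hzi (by simpa using hwi) h

theorem IsQuarticSymbol.exists_of_norm_eq_prime {q : ℕ} [Fact q.Prime] {z : GaussianInt}
    (hz : z.norm = q) (hq : q % 4 = 1) (hzi : Even z.im) : ∃ Ψ, IsQuarticSymbol z Ψ := by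
  obtain ⟨χ, hχ⟩ := MulChar.exists_mulChar_orderOf (ZMod q) (R := GaussianInt) (n := 4)
    (by rw [ZMod.card]; omega) GaussianInt.isPrimitiveRoot_sqrtd
  have h4 : χ ^ 4 = 1 := hχ ▸ pow_orderOf_eq_one χ
  have h2 : χ ^ 2 ≠ 1 := pow_ne_one_of_lt_orderOf (by norm_num) (by omega)
  have hJ := IsQuarticSymbol.jacobiSum hq h2 h4
  have hJ' := IsQuarticSymbol.jacobiSum (χ := χ⁻¹) hq (by rwa [inv_pow, inv_ne_one])
    (by rw [inv_pow, h4, inv_one])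
  rw [← star_jacobiSum_of_pow_four h4] at hJ'
  rcases GaussianInt.eq_or_eq_of_norm_eq_prime hz (norm_jacobiSum_of_pow_four h2 h4)
    (Nat.odd_iff.2 (by omega)) hzi
    (even_im_jacobiSum_of_pow_four hq h4) with (rfl | rfl) | rfl | rfl
  exacts [⟨_, hJ⟩, ⟨_, hJ.neg⟩, ⟨_, hJ'⟩, ⟨_, hJ'.neg⟩]

theorem GaussianInt.dvd_of_dvd_re_mul_star {q : ℕ} [Fact q.Prime] {z w : GaussianInt}
    (hw : w.norm = q) (h : (q : ℤ) ∣ (z * star w).re) : w ∣ z := by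
  have hq0 : (q : ℤ) ≠ 0 := mod_cast (NeZero.ne q)
  have him : (q : ℤ) ∣ (z * star w).im := by
    refine Int.Prime.dvd_pow' (k := 2) Fact.out ?_
    have hN : (z * star w).im ^ 2 = z.norm * q - (z * star w).re ^ 2 := by
      rw [← hw, ← Zsqrtd.norm_conj w, ← Zsqrtd.norm_mul, Zsqrtd.norm_def]
      ring
    rw [hN]
    exact dvd_sub (dvd_mul_left _ _) (dvd_pow h two_ne_zero)
  obtain ⟨t, ht⟩ := (Zsqrtd.intCast_dvd (q : ℤ) (z * star w)).2 ⟨h, him⟩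
  have hw0 : star w ≠ 0 := by
    rw [star_ne_zero]
    rintro rfl
    exact hq0 (by simpa using hw.symm)
  refine ⟨t, mul_right_cancel₀ hw0 ?_⟩
  rw [ht, ← hw, Zsqrtd.norm_eq_mul_conj]
  ring

theorem GaussianInt.odd_re {z : GaussianInt} (h : Odd z.norm) (hi : Even z.im) : Odd z.re := by
  rw [Zsqrtd.norm_def] at h
  have : z.re * z.re - -1 * z.im * z.im = z.re * z.re + z.im * z.im := by ring
  rw [this, Int.odd_add, Int.odd_mul] at h
  exact (h.2 (hi.mul_right _)).1

theorem GaussianInt.even_im_of_mul {z w : GaussianInt} (h : Odd z.norm) (hz : Even z.im)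
    (hzw : Even (z * w).im) : Even w.im := by
  have := GaussianInt.odd_re h hz
  rw [Zsqrtd.im_mul, Int.even_add, iff_true_right (hz.mul_right _), Int.even_mul] at hzw
  exact hzw.resolve_left (Int.not_even_iff_odd.2 this)

namespace IsQuarticSymbol

theorem exists_dvd_of_prime_dvd_norm {q : ℕ} [Fact q.Prime] (hq2 : q ≠ 2) {z : GaussianInt}
    (hz : (q : ℤ) ∣ z.norm) :
    ∃ w Ψ, w ∣ z ∧ Even w.im ∧ 1 < w.norm ∧ IsQuarticSymbol w Ψ := by
  have hq : q.Prime := Fact.out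
  have hq1 : (1 : ℤ) < q := mod_cast hq.one_lt
  have key {w : GaussianInt} (hq4 : q % 4 = 1) (hw : w.norm = q) (hwi : Even w.im)
      (h : (q : ℤ) ∣ (z * star w).re) :
      ∃ w Ψ, w ∣ z ∧ Even w.im ∧ 1 < w.norm ∧ IsQuarticSymbol w Ψ := by
    obtain ⟨Ψ, hΨ⟩ := exists_of_norm_eq_prime hw hq4 hwi
    exact ⟨w, Ψ, GaussianInt.dvd_of_dvd_re_mul_star hw h, hwi, hw ▸ hq1, hΨ⟩
  rcases Nat.odd_mod_four_iff.1 (Nat.odd_iff.1 (hq.odd_of_ne_two hq2)) with hq4 | hq4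
  · obtain ⟨w, hw, hwi⟩ : ∃ w : GaussianInt, w.norm = q ∧ Even w.im := by
      obtain ⟨a, b, hab⟩ := Nat.Prime.sq_add_sq (p := q) (by omega)
      rcases Nat.even_or_odd b with hb | hb
      · exact ⟨⟨a, b⟩, by rw [Zsqrtd.norm_def, ← hab]; push_cast; ring, by simpa using hb⟩
      · refine ⟨⟨b, a⟩, by rw [Zsqrtd.norm_def, ← hab]; push_cast; ring, ?_⟩
        have : Odd (a ^ 2 + b ^ 2) := hab ▸ hq.odd_of_ne_two hq2
        rw [Nat.odd_add', iff_true_left hb.pow, Nat.even_pow' two_ne_zero] at this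
        simpa using this
    have h : (q : ℤ) ∣ (z * w).re * (z * star w).re := by
      obtain ⟨t, ht⟩ := hz
      refine ⟨z.re ^ 2 - w.im ^ 2 * t, ?_⟩
      simp only [Zsqrtd.norm_def] at ht hw
      simp only [Zsqrtd.re_mul, Zsqrtd.re_star, Zsqrtd.im_star]
      linear_combination (z.re ^ 2) * hw - w.im ^ 2 * ht
    rcases Int.Prime.dvd_mul' Fact.out h with h | h
    · exact key (w := star w) hq4 (by rwa [Zsqrtd.norm_conj]) (by simpa using hwi)
        (by simpa using h)
    · exact key hq4 hw hwi h
  · obtain ⟨Ψ, hΨ⟩ := natCast hq2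
    have hp := GaussianInt.prime_of_nat_prime_of_mod_four_eq_three q hq4
    have hdvd : (q : GaussianInt) ∣ z := by
      have h : (q : GaussianInt) ∣ z * star z := by
        rw [← Zsqrtd.norm_eq_mul_conj]
        simpa only [map_natCast] using! map_dvd (Int.castRingHom GaussianInt) hz
      rcases hp.dvd_or_dvd h with h | h
      · exact h
      · simpa [starRingEnd_apply] using map_dvd (starRingEnd GaussianInt) h
    refine ⟨q, Ψ, hdvd, by simp, ?_, hΨ⟩
    rw [Zsqrtd.norm_natCast]
    nlinarith

theorem exists_of_odd_norm {z : GaussianInt} (hz : Odd z.norm) (hzi : Even z.im) :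
    ∃ Ψ, IsQuarticSymbol z Ψ := by
  induction hn : z.norm.natAbs using Nat.strong_induction_on generalizing z with
  | _ n ih =>
    have hz0 : z ≠ 0 := by rintro rfl; simp at hz
    by_cases h1 : n = 1
    · rw [h1] at hn
      have hN : z.re * z.re - -1 * z.im * z.im = 1 := by
        rw [← Zsqrtd.norm_def]
        have := GaussianInt.norm_nonneg z
        omega
      have him : z.im = 0 := by
        obtain ⟨t, ht⟩ := hzi
        rw [ht] at hN ⊢
        by_contra h
        have : 0 < t ^ 2 := sq_pos_of_ne_zero (by rintro rfl; simp at h)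
        nlinarith [mul_self_nonneg z.re]
      rw [him, mul_zero, sub_zero] at hN
      rcases mul_self_eq_one_iff.1 hN with h | h
      · exact ⟨1, by convert one; exact Zsqrtd.ext h him⟩
      · exact ⟨1, by convert one.neg; exact Zsqrtd.ext h him⟩
    have : Fact n.minFac.Prime := ⟨Nat.minFac_prime h1⟩
    have hdvd : (n.minFac : ℤ) ∣ z.norm := Int.natCast_dvd.2 (hn ▸ n.minFac_dvd)
    have hne : n.minFac ≠ 2 := by
      intro h
      rw [h] at hdvd
      exact Int.not_even_iff_odd.2 hz (even_iff_two_dvd.2 hdvd)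
    obtain ⟨w, Ψ, ⟨t, rfl⟩, hwi, hw1, hΨ⟩ := exists_dvd_of_prime_dvd_norm hne hdvd
    rw [Zsqrtd.norm_mul] at hz hn
    rw [Int.odd_mul] at hz
    have ht0 : t ≠ 0 := right_ne_zero_of_mul hz0
    have htn : t.norm.natAbs < n := by
      rw [← hn, Int.natAbs_mul]
      have : 0 < t.norm.natAbs := by
        simpa [Nat.pos_iff_ne_zero, GaussianInt.norm_eq_zero] using ht0
      nlinarith [show 1 < w.norm.natAbs by omega]
    obtain ⟨Φ, hΦ⟩ := ih _ htn hz.2 (GaussianInt.even_im_of_mul hz.1 hwi hzi) rfl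
    exact ⟨Ψ * Φ, hΨ.mul (left_ne_zero_of_mul hz0) ht0 hΦ⟩

end IsQuarticSymbol

/-- The ring homomorphism `ℤ[i] →+* R` sending `i` to a given square root of `-1`. -/
def GaussianInt.lift {R : Type*} [CommRing R] {I : R} (hI : I ^ 2 = -1) : GaussianInt →+* R :=
  Zsqrtd.lift ⟨I, by rw [← sq, hI]; simp⟩

theorem GaussianInt.lift_apply {R : Type*} [CommRing R] {I : R} (hI : I ^ 2 = -1)
    (z : GaussianInt) : GaussianInt.lift hI z = z.re + z.im * I := rfl

theorem intCast_pow_char (k : Type*) [CommRing k] {p : ℕ} [Fact p.Prime] [CharP k p] (n : ℤ) :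
    (n : k) ^ p = n :=
  (frobenius_def p _).symm.trans (map_intCast (frobenius k p) n)

namespace IsQuarticSymbol

variable {k : Type} [Field k] {p : ℕ} [Fact p.Prime] [CharP k p] {I : k}

theorem three_add_pow_of_one_mod_four (hI : I ^ 2 = -1) (hp : p % 4 = 1)
    (h10 : (10 : k) ≠ 0) {X y : ℤ} (hXy : (X : k) ^ 2 = -10 * y ^ 2) (hy : (y : k) ≠ 0)
    {Ψ : ℤ →* GaussianInt} (h : IsQuarticSymbol ⟨X, 3 * y⟩ Ψ) {δ : ℤ} (hδ : Ψ p = δ)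
    (hδ1 : δ * δ = 1) (h2 : (2 : k) ^ (2 * (p / 4)) * 2 ^ (2 * (p / 4)) = 1) :
    (3 + I) ^ (2 * (p / 4)) = δ * 2 ^ (2 * (p / 4)) := by
  have hIp : I ^ p = I := by
    rw [← Nat.div_add_mod p 4, hp, pow_succ, pow_mul, show I ^ 4 = (I ^ 2) ^ 2 by ring, hI]
    simp
  have hpN : ¬ (p : ℤ) ∣ (⟨X, 3 * y⟩ : GaussianInt).norm := by
    rw [← CharP.intCast_eq_zero_iff k p, Zsqrtd.norm_def]
    push_cast
    intro h
    exact pow_ne_zero 2 hy (by linear_combination hXy - h)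
  have hr := h.recip_one p k (GaussianInt.lift hI) hp hpN
  simp only [GaussianInt.lift_apply, hδ, Zsqrtd.re_star, Zsqrtd.im_star, Zsqrtd.re_intCast,
    Zsqrtd.im_intCast, Int.cast_zero, zero_mul, add_zero] at hr
  push_cast at hr
  set e := p / 4
  have hpe : p = 2 * (2 * e) + 1 := by omega
  set s : k := -I * X / y with hs
  have hs2 : s ^ 2 = 10 := by
    rw [hs, div_pow, mul_pow, neg_sq, hI, hXy]
    field_simp
  have hsp : s ^ p = s := by
    rw [hs, div_pow, mul_pow, (Nat.odd_iff.2 (by omega) : Odd p).neg_pow, hIp, intCast_pow_char,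
      intCast_pow_char]
  have hZ : (X : k) + 3 * y * I = y * I * (3 + s) := by
    rw [hs]; field_simp; linear_combination X * hI
  have hs3 : (3 + s) ^ (2 * e) = δ := by
    have hn : (X + 3 * y * I) * (X + 3 * y * -I) = -(y : k) ^ 2 := by
      linear_combination hXy - 9 * y ^ 2 * hI
    have h1 : (X + 3 * y * I) ^ (2 * e) = (-(y : k) ^ 2) ^ e * δ := by
      rw [← hn, mul_pow, two_mul, pow_add]
      linear_combination -(X + 3 * y * I) ^ e * hr
    have hy2 : (-(y : k) ^ 2) ^ e ≠ 0 := pow_ne_zero _ (neg_ne_zero.2 (pow_ne_zero 2 hy))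
    refine mul_left_cancel₀ hy2 ?_
    rw [← h1, hZ, mul_pow, pow_mul (y * I), mul_pow, hI]
    congr 2; ring
  have hw : 2 * (3 + s) * (3 + I) = (3 + I + s) ^ 2 := by linear_combination -hs2 - hI
  have h20 : (2 : k) ≠ 0 := fun h ↦ h10 (by linear_combination 5 * h)
  have hw0 : 3 + I + s ≠ 0 := by
    intro h0
    rw [h0, zero_pow two_ne_zero] at hw
    have : (2 : k) * 10 = 0 := by
      linear_combination (3 - I) * (s - 3) * hw - 2 * (3 - I) * (3 + I) * hs2 + 2 * hI
    exact mul_ne_zero h20 h10 this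
  have hwp : (3 + I + s) ^ (2 * (2 * e)) = 1 := by
    have : (3 + I + s) ^ p = 3 + I + s := by
      rw [add_pow_char, add_pow_char, hIp, hsp]
      congr 2
      exact_mod_cast intCast_pow_char k 3
    rw [hpe, pow_succ] at this
    exact mul_right_cancel₀ hw0 (this.trans (one_mul _).symm)
  rw [pow_mul, ← hw, mul_pow, mul_pow, hs3] at hwp
  have hδ2 : (δ : k) * δ = 1 := mod_cast congrArg (Int.cast (R := k)) hδ1
  linear_combination δ * 2 ^ (2 * e) * hwp - (3 + I) ^ (2 * e) * hδ2 -
    (3 + I) ^ (2 * e) * δ * δ * h2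

theorem three_add_pow_of_three_mod_eight (hI : I ^ 2 = -1) (hp : p % 8 = 3)
    (h10 : (10 : k) ≠ 0) {x y a b : ℤ} (ha : -a - b = x) (hb : a - b = 3 * y)
    (hXy : (x : k) ^ 2 = -10 * y ^ 2) (hy : (y : k) ≠ 0)
    {Ψ : ℤ →* GaussianInt} (h : IsQuarticSymbol ⟨a, b⟩ Ψ)
    (hδ : (J(2 | (⟨a, b⟩ : GaussianInt).norm.natAbs) : ℤ) * Ψ p =
      (((-1) ^ (p / 8) : ℤ) : GaussianInt))
    (h2 : (2 : k) ^ (p / 2) = -1) :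
    y * (1 - 3 * I) * (3 + I) ^ (p / 2) = x := by
  set c := p / 8 with hc
  have hpc : p = 8 * c + 3 := by omega
  have hIp : I ^ p = -I := by
    rw [hpc, pow_add, pow_mul, show I ^ 8 = (I ^ 2) ^ 4 by ring, hI]
    linear_combination I * hI
  have hIc : I ^ (2 * c + 1) = (-1) ^ c * I := by rw [pow_succ, pow_mul, hI]
  have hI2 : ((-1 : k) ^ c) * (-1) ^ c = 1 := by rw [← mul_pow]; simp
  have h20 : (2 : k) ≠ 0 := fun h ↦ h10 (by linear_combination 5 * h)
  have hx : (-a - b : k) = x := mod_cast congrArg (Int.cast (R := k)) ha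
  have hy3 : (a - b : k) = 3 * y := mod_cast congrArg (Int.cast (R := k)) hb
  have hN : (2 : k) * (a * a + b * b) = -y ^ 2 := by
    linear_combination hXy - (a + b - x) * hx + (a - b + 3 * y) * hy3
  have hpN : ¬ (p : ℤ) ∣ (⟨a, b⟩ : GaussianInt).norm := by
    rw [← CharP.intCast_eq_zero_iff k p, Zsqrtd.norm_def]
    push_cast
    intro h
    exact pow_ne_zero 2 hy (by linear_combination hN - 2 * h)
  have hr := h.recip_three p k (GaussianInt.lift hI) (by omega) hpN
  have hδ' := congrArg (GaussianInt.lift hI) hδ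
  rw [map_mul, map_intCast, map_intCast] at hδ'
  rw [hδ', GaussianInt.lift_apply, GaussianInt.lift_apply,
    show p / 4 + 1 = 2 * c + 1 by omega] at hr
  simp only [Zsqrtd.re_star, Zsqrtd.im_star] at hr
  push_cast at hr
  set s : k := -I * x / y with hs
  have hs2 : s ^ 2 = 10 := by
    rw [hs, div_pow, mul_pow, neg_sq, hI, hXy]
    field_simp
  have hsp : s ^ p = -s := by
    rw [hs, div_pow, mul_pow, (Nat.odd_iff.2 (by omega) : Odd p).neg_pow, hIp, intCast_pow_char,
      intCast_pow_char]
    ring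
  have hZ : (x : k) + 3 * y * I = y * I * (3 + s) := by
    rw [hs]; field_simp; linear_combination x * hI
  have hZ1 : (x : k) + 3 * y * I = (I - 1) * (a + b * I) := by
    linear_combination -hx - I * hy3 - b * hI
  have hZ2 : (x : k) - 3 * y * I = I * (I - 1) * (a + -b * I) := by
    linear_combination -hx + I * hy3 - (a + b - b * I) * hI
  have hs3 : (3 + s) ^ (2 * (2 * c + 1)) = -I := by
    have hn : ((x : k) + 3 * y * I) * (x - 3 * y * I) = -(y : k) ^ 2 := by
      linear_combination hXy - 9 * y ^ 2 * hI
    have h1 : ((x : k) - 3 * y * I) ^ (2 * c + 1) = I * (x + 3 * y * I) ^ (2 * c + 1) := by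
      rw [hZ1, hZ2, mul_pow, mul_pow, hr, hIc, mul_pow]
      linear_combination I * (I - 1) ^ (2 * c + 1) * (a + b * I) ^ (2 * c + 1) * hI2
    have h2 : (-(y : k) ^ 2) ^ (2 * c + 1) = I * (x + 3 * y * I) ^ (2 * (2 * c + 1)) := by
      rw [← hn, mul_pow, h1]
      ring
    have hy2 : (-(y : k) ^ 2) ^ (2 * c + 1) ≠ 0 :=
      pow_ne_zero _ (neg_ne_zero.2 (pow_ne_zero 2 hy))
    refine mul_left_cancel₀ hy2 ?_
    have h3 : (x + 3 * y * I) ^ (2 * (2 * c + 1)) =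
        (-(y : k) ^ 2) ^ (2 * c + 1) * (3 + s) ^ (2 * (2 * c + 1)) := by
      rw [hZ, mul_pow, pow_mul (y * I), mul_pow, hI]
      congr 2; ring
    rw [← h3]
    linear_combination I * h2 + (x + 3 * y * I) ^ (2 * (2 * c + 1)) * hI
  have hw : 2 * (3 + s) * (3 + I) = (3 + I + s) ^ 2 := by linear_combination -hs2 - hI
  have hwp : (3 + I + s) ^ (2 * (2 * (2 * c + 1))) = (3 - I - s) * (3 + I + s) := by
    rw [show 2 * (2 * (2 * c + 1)) = p + 1 by omega, pow_succ, add_pow_char, add_pow_char, hIp,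
      hsp, show (3 : k) ^ p = 3 from mod_cast intCast_pow_char k 3]
    ring
  rw [pow_mul, ← hw, mul_pow, mul_pow, hs3, show 2 * (2 * c + 1) = p / 2 + 1 by omega, pow_succ,
    pow_succ, h2] at hwp
  have hys : y * s = -I * x := by rw [hs]; field_simp
  refine mul_left_cancel₀ h20 ?_
  linear_combination -y * hwp + 2 * y * (3 + I) ^ (p / 2) * hI + 2 * I * hys - 2 * x * hI
    + y * hI + y * hs2

end IsQuarticSymbol

theorem Int.sq_emod_eight_of_odd {n : ℤ} (hn : Odd n) : n ^ 2 % 8 = 1 := by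
  obtain ⟨t, rfl⟩ := hn
  obtain ⟨u, hu⟩ := Int.even_mul_succ_self t
  have : (2 * t + 1) ^ 2 = 8 * u + 1 := by linear_combination 4 * hu
  omega

theorem jacobiSym_eq_of_one_mod_four {N : ℕ} (hN : N % 4 = 1) {y : ℤ} (hy : Odd y) :
    J(y | N) = J(N | y.natAbs) := by
  have hodd : Odd y.natAbs := Int.natAbs_odd.2 hy
  rw [jacobiSym.quadratic_reciprocity_one_mod_four hN hodd]
  rcases Int.natAbs_eq y with h | h
  · rw [← h]
  · nth_rewrite 1 [h]
    rw [jacobiSym.neg _ (Nat.odd_iff.2 (by omega)), ZMod.χ₄_nat_one_mod_four hN, one_mul]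

theorem jacobiSym_eq_one_of_eq_sq {n X y : ℤ} (h : y ∣ n - X ^ 2) (hX : IsCoprime X y) :
    J(n | y.natAbs) = 1 := by
  have : n % (y.natAbs : ℤ) = X ^ 2 % (y.natAbs : ℤ) := by
    refine (Int.modEq_iff_dvd.2 ?_).symm
    exact Int.natAbs_dvd.2 h
  rw [jacobiSym.mod_left' this]
  exact jacobiSym.sq_one' (by
    rw [Int.gcd_def, Int.natAbs_natCast]
    exact Int.isCoprime_iff_gcd_eq_one.1 hX)

theorem jacobiSym_two_of_one_mod_eight {N : ℕ} (h : N % 8 = 1) : J(2 | N) = 1 := by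
  rw [jacobiSym.at_two (Nat.odd_iff.2 (by omega)), ZMod.χ₈_nat_eq_if_mod_eight,
    if_neg (by omega), if_pos (by omega)]

theorem jacobiSym_two_of_five_mod_eight {N : ℕ} (h : N % 8 = 5) : J(2 | N) = -1 := by
  rw [jacobiSym.at_two (Nat.odd_iff.2 (by omega)), ZMod.χ₈_nat_eq_if_mod_eight,
    if_neg (by omega), if_neg (by omega)]

theorem jacobiSym_of_even {X y : ℤ} {N : ℕ} (hN : (N : ℤ) = X ^ 2 + 9 * y ^ 2) (hX : Odd X)
    (hy : Even y) (hy0 : y ≠ 0) (hXy : IsCoprime X y) :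
    J(y | N) = (-1) ^ (y / 2).natAbs := by
  have key {z : ℤ} (hz : Odd z) (hzy : z ∣ y) (hN4 : N % 4 = 1) : J(z | N) = 1 := by
    rw [jacobiSym_eq_of_one_mod_four hN4 hz]
    refine jacobiSym_eq_one_of_eq_sq (X := X) ?_ (hXy.of_isCoprime_of_dvd_right hzy)
    rw [hN, add_sub_cancel_left]
    exact (dvd_pow hzy two_ne_zero).mul_left _
  obtain ⟨t, rfl⟩ := hy.two_dvd
  have hX8 : X ^ 2 % 8 = 1 := Int.sq_emod_eight_of_odd hX
  rw [Int.mul_ediv_cancel_left _ two_ne_zero]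
  rcases Int.even_or_odd t with ht | ht
  · have hN8 : N % 8 = 1 := by
      obtain ⟨u, rfl⟩ := ht.two_dvd
      ring_nf at hN
      omega
    obtain ⟨z, h, hz⟩ :=
      (Int.finiteMultiplicity_iff (a := 2).2 ⟨by decide, hy0⟩).exists_eq_pow_mul_and_not_dvd
    rw [← even_iff_two_dvd, Int.not_even_iff_odd] at hz
    rw [h, jacobiSym.mul_left, jacobiSym.pow_left, jacobiSym_two_of_one_mod_eight hN8,
      key hz (h ▸ dvd_mul_left _ _) (by omega), (Int.natAbs_even.2 ht).neg_one_pow]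
    simp
  · have hN8 : N % 8 = 5 := by
      have := Int.sq_emod_eight_of_odd ht
      ring_nf at hN
      omega
    rw [jacobiSym.mul_left, jacobiSym_two_of_five_mod_eight hN8,
      key ht (dvd_mul_left _ _) (by omega), (Int.natAbs_odd.2 ht).neg_one_pow]
    rfl

theorem ZMod.three_pow_div_two (p : ℕ) [Fact p.Prime] (hp2 : p ≠ 2) (hp3 : p ≠ 3) :
    (3 : ZMod p) ^ (p / 2) = if p % 4 = 1 then (-1) ^ (p / 3) else -(-1) ^ (p / 3) := by
  have hodd := Nat.odd_iff.1 ((Fact.out : p.Prime).odd_of_ne_two hp2)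
  have h3 : legendreSym 3 p = (-1) ^ (p / 3) := by
    have h0 : p % 3 ≠ 0 := fun h ↦
      hp3 ((Nat.prime_dvd_prime_iff_eq Nat.prime_three Fact.out).1 (Nat.dvd_of_mod_eq_zero h)).symm
    rw [legendreSym.mod]
    rcases (by omega : p % 3 = 1 ∨ p % 3 = 2) with h | h
    · rw [show (p : ℤ) % (3 : ℕ) = 1 by omega, legendreSym.at_one,
        Even.neg_one_pow (Nat.even_iff.2 (by omega))]
    · rw [show (p : ℤ) % (3 : ℕ) = 2 by omega, Odd.neg_one_pow (Nat.odd_iff.2 (by omega))]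
      decide
  have h := legendreSym.eq_pow p 3
  rw [Int.cast_ofNat] at h
  rw [← h]
  split_ifs with h4
  · rw [← Nat.cast_ofNat, ← legendreSym.quadratic_reciprocity_one_mod_four h4 (by norm_num), h3]
    simp
  · rw [← Nat.cast_ofNat,
      legendreSym.quadratic_reciprocity_three_mod_four (p := 3) (by norm_num) (by omega), h3]
    simp

theorem ZMod.two_pow_div_two (p : ℕ) [Fact p.Prime] (hp2 : p ≠ 2) :
    (2 : ZMod p) ^ (p / 2) = if p % 8 = 1 ∨ p % 8 = 7 then 1 else -1 := by
  have hodd := Nat.odd_iff.1 ((Fact.out : p.Prime).odd_of_ne_two hp2)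
  have h := legendreSym.eq_pow p 2
  rw [legendreSym.at_two hp2, ZMod.χ₈_nat_eq_if_mod_eight, if_neg (by omega), Int.cast_ofNat] at h
  rw [← h]
  split_ifs <;> simp

theorem intCast_ne_zero_of_isCoprime {p : ℕ} [Fact p.Prime] {X y c : ℤ} (hXy : IsCoprime X y)
    (h : X ^ 2 + 10 * y ^ 2 = c * p) : (y : ZMod p) ≠ 0 := by
  rw [Ne, ZMod.intCast_zmod_eq_zero_iff_dvd]
  intro hy
  have hX : (p : ℤ) ∣ X := Int.Prime.dvd_pow' (k := 2) Fact.out <| by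
    rw [eq_sub_of_add_eq h]
    exact (dvd_mul_left _ _).sub ((dvd_pow hy two_ne_zero).mul_left _)
  exact (Nat.prime_iff_prime_int.1 Fact.out).not_isUnit (hXy.isUnit_of_dvd' hX hy)

theorem isCoprime_of_prime_eq {p : ℕ} (hp : p.Prime) {x y a b : ℤ}
    (h : (p : ℤ) = a * x ^ 2 + b * y ^ 2) : IsCoprime x y := by
  rw [← gcd_isUnit_iff]
  refine (Nat.prime_iff_prime_int.1 hp).squarefree _ ?_
  rw [h, ← sq]
  exact ((pow_dvd_pow_of_dvd (gcd_dvd_left x y) 2).mul_left _).add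
    ((pow_dvd_pow_of_dvd (gcd_dvd_right x y) 2).mul_left _)

theorem neg_one_zpow_eq_pow_natAbs {K : Type*} [DivisionRing K] (n : ℤ) :
    (-1 : K) ^ n = (-1) ^ n.natAbs := by
  rcases Int.natAbs_eq n with h | h
  · nth_rewrite 1 [h]
    exact zpow_natCast _ _
  · nth_rewrite 1 [h]
    rw [zpow_neg, zpow_natCast, ← inv_pow, inv_neg_one]

theorem sum_eq_of_one_mod_four {p : ℕ} [Fact p.Prime] (hp : p % 4 = 1) (hp5 : p ≠ 5) {X y c : ℤ}
    (hXy : IsCoprime X y) (h : X ^ 2 + 10 * y ^ 2 = c * p) {Ψ : ℤ →* GaussianInt}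
    (hΨ : IsQuarticSymbol ⟨X, 3 * y⟩ Ψ) {δ : ℤ} (hδ : Ψ p = δ) (hδ1 : δ * δ = 1) :
    ∑ k ∈ range (p / 4 + 1), (Nat.choose (4 * k) (2 * k) : ZMod p) / (-144 : ZMod p) ^ k =
      (-1) ^ (p / 3) * 2 ^ (p / 2) * δ := by
  have hp2 : p ≠ 2 := by omega
  obtain ⟨I, hI⟩ := ZMod.exists_sq_eq_neg_one_iff.2 (show p % 4 ≠ 3 by omega)
  rw [← sq, eq_comm] at hI
  have hI' : (-I) ^ 2 = -1 := by rw [neg_sq, hI]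
  have h20 : (2 : ZMod p) ≠ 0 :=
    mod_cast natCast_ne_zero_of_prime_ne (K := ZMod p) Nat.prime_two hp2
  have h50 : (5 : ZMod p) ≠ 0 :=
    mod_cast natCast_ne_zero_of_prime_ne (K := ZMod p) Nat.prime_five hp5
  have h10 : (10 : ZMod p) ≠ 0 := by
    rw [show (10 : ZMod p) = 2 * 5 by norm_num]
    exact mul_ne_zero h20 h50
  have hX : (X : ZMod p) ^ 2 = -10 * y ^ 2 := by
    have := congrArg (Int.cast (R := ZMod p)) h
    push_cast at this
    rw [CharP.cast_eq_zero] at this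
    linear_combination this
  have hm : 2 * (p / 4) = p / 2 := by omega
  have h2 : (2 : ZMod p) ^ (p / 2) * 2 ^ (p / 2) = 1 := by
    rw [ZMod.two_pow_div_two p hp2]; split_ifs <;> simp
  have h3 := ZMod.three_pow_div_two p hp2 (by omega)
  rw [if_pos hp] at h3
  have hy := intCast_ne_zero_of_isCoprime hXy h
  have e1 := hΨ.three_add_pow_of_one_mod_four hI hp h10 hX hy hδ hδ1 (by rwa [hm])
  have e2 := hΨ.three_add_pow_of_one_mod_four hI' hp h10 hX hy hδ hδ1 (by rwa [hm])
  have e := two_mul_three_pow_mul_sum (show 2 * (p / 2) + 1 = p by omega) (by omega) hI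
  rw [hm] at e1 e2
  rw [← sub_eq_add_neg] at e2
  rw [e1, e2, h3] at e
  have h33 : (-1 : ZMod p) ^ (p / 3) * (-1) ^ (p / 3) = 1 := by rw [← mul_pow]; simp
  refine mul_left_cancel₀ h20 ?_
  linear_combination (-1) ^ (p / 3) * e -
    2 * (∑ k ∈ range (p / 4 + 1),
      (Nat.choose (4 * k) (2 * k) : ZMod p) / (-144 : ZMod p) ^ k) * h33

theorem IsQuarticSymbol.exists_apply_mul_eq {X y c n : ℤ} (hX : Odd X) (hy : Even y) (hy0 : y ≠ 0)
    (hXy : IsCoprime X y) (h : X ^ 2 + 10 * y ^ 2 = c * n) :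
    ∃ Ψ, IsQuarticSymbol ⟨X, 3 * y⟩ Ψ ∧ Ψ c * Ψ n = ((-1) ^ (y / 2).natAbs : ℤ) := by
  have hN : (⟨X, 3 * y⟩ : GaussianInt).norm = X ^ 2 + 9 * y ^ 2 := by
    rw [Zsqrtd.norm_def]; ring
  obtain ⟨Ψ, hΨ⟩ := IsQuarticSymbol.exists_of_odd_norm (z := ⟨X, 3 * y⟩)
    (by rw [hN]; exact hX.pow.add_even ((hy.pow_of_ne_zero two_ne_zero).mul_left _))
    (hy.mul_left 3)
  refine ⟨Ψ, hΨ, ?_⟩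
  rw [← map_mul, hΨ.periodic (c * n) (y ^ 2) ⟨1, by rw [hN]; linear_combination -h⟩, map_pow,
    hΨ.sq, jacobiSym_of_even (X := X) ?_ hX hy hy0 hXy]
  rw [Int.natCast_natAbs, abs_of_nonneg (GaussianInt.norm_nonneg _), hN]

theorem IsQuarticSymbol.apply_five {X y : ℤ} (hX : Odd X) (hy : Even y)
    (hXy : IsCoprime X y) (h5 : 5 ∣ X) {Ψ : ℤ →* GaussianInt} (h : IsQuarticSymbol ⟨X, 3 * y⟩ Ψ) :
    Ψ 5 = -1 := by
  have : Fact (Nat.Prime 5) := ⟨by norm_num⟩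
  have hN : (⟨X, 3 * y⟩ : GaussianInt).norm = X ^ 2 + 9 * y ^ 2 := by
    rw [Zsqrtd.norm_def]; ring
  have hy5 : ¬ (5 : ℤ) ∣ y := fun hy5 ↦ (by decide : ¬ IsUnit (5 : ℤ)) (hXy.isUnit_of_dvd' h5 hy5)
  have hodd : Odd (⟨X, 3 * y⟩ : GaussianInt).norm.natAbs := by
    rw [Int.natAbs_odd, hN]
    exact hX.pow.add_even ((hy.pow_of_ne_zero two_ne_zero).mul_left _)
  have hsq : Ψ 5 ^ 2 = 1 := by
    have h1 : J((5 : ℕ) | (⟨X, 3 * y⟩ : GaussianInt).norm.natAbs) = 1 := by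
      rw [jacobiSym.quadratic_reciprocity_one_mod_four (by norm_num) hodd, Int.natCast_natAbs,
        abs_of_nonneg (GaussianInt.norm_nonneg _)]
      refine jacobiSym_eq_one_of_eq_sq (X := 3 * y) (y := 5) ?_ ?_
      · rw [hN]
        obtain ⟨t, rfl⟩ := h5
        exact ⟨5 * t ^ 2, by ring⟩
      · exact IsCoprime.mul_left (by norm_num)
          ((Nat.prime_iff_prime_int.1 Nat.prime_five).coprime_iff_not_dvd.2 hy5).symm
    rw [h.sq]
    exact (congrArg (Int.cast (R := GaussianInt)) h1).trans Int.cast_one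
  refine (mul_self_eq_one_iff.1 ((_root_.sq _).symm.trans hsq)).resolve_left fun h1 ↦ ?_
  have hn : ¬ ((5 : ℕ) : ℤ) ∣ (⟨X, 3 * y⟩ : GaussianInt).norm := by
    rw [hN]
    intro hdvd
    rw [(Nat.cast_ofNat : ((5 : ℕ) : ℤ) = 5), dvd_add_right (dvd_pow h5 two_ne_zero)] at hdvd
    rcases (Int.prime_iff_natAbs_prime.2 (by norm_num) : Prime (5 : ℤ)).dvd_or_dvd hdvd with h | h
    · omega
    · exact hy5 ((Int.prime_iff_natAbs_prime.2 (by norm_num) : Prime (5 : ℤ)).dvd_of_dvd_pow h)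
  have hI : (2 : ZMod 5) ^ 2 = -1 := rfl
  have hr := h.recip_one 5 (ZMod 5) (GaussianInt.lift hI) (by norm_num) hn
  rw [(Nat.cast_ofNat : ((5 : ℕ) : ℤ) = 5), h1, map_one, mul_one, GaussianInt.lift_apply,
    GaussianInt.lift_apply, show 5 / 4 = 1 by rfl, pow_one, pow_one] at hr
  simp only [Zsqrtd.re_star, Zsqrtd.im_star] at hr
  push_cast at hr
  refine hy5 ((ZMod.intCast_zmod_eq_zero_iff_dvd y 5).1 ?_)
  have h5 : (5 : ZMod 5) = 0 := rfl
  linear_combination 2 * hr + 5 * y * h5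

theorem neg_one_zpow_natCast_div_add {K : Type*} [DivisionRing K] (a b : ℕ) (n : ℤ) :
    (-1 : K) ^ ((a : ℤ) / b + n) = (-1) ^ (a / b) * (-1) ^ n.natAbs := by
  rw [zpow_add₀ (neg_ne_zero.2 one_ne_zero), neg_one_zpow_eq_pow_natAbs n, ← Int.natCast_div,
    zpow_natCast]

theorem sum_eq_neg_one_zpow_of_one_mod_eight {p : ℕ} [Fact p.Prime] (hp : p % 8 = 1) {x y : ℤ}
    (h : (p : ℤ) = x ^ 2 + 10 * y ^ 2) :
    Even y ∧ ∑ k ∈ range (p / 4 + 1),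
      (Nat.choose (4 * k) (2 * k) : ZMod p) / (-144 : ZMod p) ^ k =
        (-1) ^ ((p : ℤ) / 3 + y / 2) := by
  have hx : Odd x := by
    have : Odd (x ^ 2) := Int.odd_iff.2 (by omega)
    exact Int.odd_pow' two_ne_zero |>.1 this
  have hy : Even y := by
    by_contra hy
    have := Int.sq_emod_eight_of_odd hx
    have := Int.sq_emod_eight_of_odd (Int.not_even_iff_odd.1 hy)
    omega
  have hxy : IsCoprime x y := isCoprime_of_prime_eq Fact.out (a := 1) (b := 10) (by rw [h]; ring)
  have h' : x ^ 2 + 10 * y ^ 2 = 1 * p := by rw [h]; ring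
  have hy0 : y ≠ 0 := by
    rintro rfl
    exact intCast_ne_zero_of_isCoprime hxy h' Int.cast_zero
  obtain ⟨Ψ, hΨ, e⟩ := IsQuarticSymbol.exists_apply_mul_eq hx hy hy0 hxy h'
  rw [map_one, one_mul] at e
  refine ⟨hy, ?_⟩
  rw [sum_eq_of_one_mod_four (by omega) (by omega) hxy h' hΨ e (by rw [← mul_pow]; simp),
    ZMod.two_pow_div_two p (by omega), if_pos (.inl hp), mul_one]
  push_cast
  exact (neg_one_zpow_natCast_div_add p 3 _).symm

theorem sum_eq_neg_one_zpow_of_five_mod_eight {p : ℕ} [Fact p.Prime] (hp : p % 8 = 5)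
    (hp5 : p ≠ 5) {x y : ℤ} (h : (p : ℤ) = 5 * x ^ 2 + 2 * y ^ 2) :
    Even y ∧ ∑ k ∈ range (p / 4 + 1),
      (Nat.choose (4 * k) (2 * k) : ZMod p) / (-144 : ZMod p) ^ k =
        (-1) ^ ((p : ℤ) / 3 + y / 2) := by
  have hx : Odd x := by
    have : Odd (x ^ 2) := Int.odd_iff.2 (by omega)
    exact Int.odd_pow' two_ne_zero |>.1 this
  have hy : Even y := by
    by_contra hy
    have := Int.sq_emod_eight_of_odd hx
    have := Int.sq_emod_eight_of_odd (Int.not_even_iff_odd.1 hy)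
    omega
  have hxy : IsCoprime (5 * x) y := by
    refine IsCoprime.mul_left ?_ (isCoprime_of_prime_eq Fact.out h)
    refine (Nat.prime_iff_prime_int.1 Nat.prime_five).coprime_iff_not_dvd.2 fun hdvd ↦ hp5 ?_
    refine ((Nat.prime_dvd_prime_iff_eq Nat.prime_five Fact.out).1
      (Int.natCast_dvd_natCast.1 ?_)).symm
    rw [h]
    exact (dvd_mul_right _ _).add ((dvd_pow hdvd two_ne_zero).mul_left _)
  have h' : (5 * x) ^ 2 + 10 * y ^ 2 = 5 * p := by rw [h]; ring
  have hy0 : y ≠ 0 := by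
    rintro rfl
    exact intCast_ne_zero_of_isCoprime hxy h' Int.cast_zero
  have hX : Odd (5 * x) := (by decide : Odd (5 : ℤ)).mul hx
  obtain ⟨Ψ, hΨ, e⟩ := IsQuarticSymbol.exists_apply_mul_eq hX hy hy0 hxy h'
  rw [hΨ.apply_five hX hy hxy (dvd_mul_right _ _), neg_one_mul, neg_eq_iff_eq_neg,
    ← Int.cast_neg] at e
  refine ⟨hy, ?_⟩
  rw [sum_eq_of_one_mod_four (by omega) hp5 hxy h' hΨ e (by rw [neg_mul_neg, ← mul_pow]; simp),
    ZMod.two_pow_div_two p (by omega), if_neg (by omega), mul_assoc]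
  push_cast
  rw [neg_mul_neg, one_mul]
  exact (neg_one_zpow_natCast_div_add p 3 _).symm

theorem jacobiSym_two_mul_jacobiSym {p N : ℕ} (hp : p % 8 = 3) {x y : ℤ} (hy : Odd y)
    (hxy : IsCoprime x y) (h : (p : ℤ) = x ^ 2 + 10 * y ^ 2) (h4 : 4 ∣ x - y)
    (hN : 2 * (N : ℤ) = x ^ 2 + 9 * y ^ 2) : J(2 | N) * J(y | N) = (-1) ^ (p / 8) := by
  obtain ⟨t, ht⟩ := h4
  obtain rfl : x = y + 4 * t := by linear_combination ht
  obtain ⟨v, hv, hv2⟩ : ∃ v, v = y.natAbs ∧ y ^ 2 = v ^ 2 := ⟨_, rfl, (Int.natAbs_sq y).symm⟩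
  have hvodd : Odd v := hv ▸ Int.natAbs_odd.2 hy
  have hp' : (p : ℤ) = 11 * v ^ 2 + 8 * (t * y) + 16 * t ^ 2 := by
    rw [h, ← hv2]; ring
  have hN' : (N : ℤ) = 5 * v ^ 2 + 4 * (t * y) + 8 * t ^ 2 := by
    rw [← hv2]; linarith
  have hN4 : N % 4 = 1 := by
    have : ((v : ℤ) ^ 2) % 8 = 1 := Int.sq_emod_eight_of_odd (by exact_mod_cast hvodd)
    omega
  have h2 : J(y | N) = J(2 | v) := by
    have h1 : J(2 | v) * J(N | v) = 1 := by
      rw [← jacobiSym.mul_left, hN, hv]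
      exact jacobiSym_eq_one_of_eq_sq (X := y + 4 * t) ⟨9 * y, by ring⟩ hxy
    rw [jacobiSym_eq_of_one_mod_four hN4 hy, ← hv]
    exact (Int.eq_of_mul_eq_one h1).symm
  have hJ {a b : ℕ} (h : J(2 | N) = (-1) ^ a) (h' : J(2 | v) = (-1) ^ b)
      (hab : (a + b) % 2 = p / 8 % 2) : J(2 | N) * J(y | N) = (-1) ^ (p / 8) := by
    rw [h2, h, h', ← pow_add, neg_one_pow_eq_pow_mod_two, hab, ← neg_one_pow_eq_pow_mod_two]
  have hvmod := Nat.odd_iff.1 hvodd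
  have h8 : v % 8 = 1 ∨ v % 8 = 7 ∨ v % 8 = 3 ∨ v % 8 = 5 := by omega
  have hN8 : N % 8 = 1 ∨ N % 8 = 5 := by omega
  have hv16 : ((v % 8 = 1 ∨ v % 8 = 7) ∧ (v : ℤ) ^ 2 % 16 = 1 ∧ J(2 | v) = (-1) ^ 0) ∨
      (¬ (v % 8 = 1 ∨ v % 8 = 7) ∧ (v : ℤ) ^ 2 % 16 = 9 ∧ J(2 | v) = (-1) ^ 1) := by
    have hmod : v ^ 2 % 16 = (v % 8) ^ 2 % 16 := by
      conv_lhs => rw [← Nat.mod_add_div v 8, show (v % 8 + 8 * (v / 8)) ^ 2 =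
        (v % 8) ^ 2 + 16 * ((v % 8) * (v / 8) + 4 * (v / 8) ^ 2) by ring, Nat.add_mul_mod_self_left]
    rw [jacobiSym.at_two hvodd, ZMod.χ₈_nat_eq_if_mod_eight, if_neg (by omega)]
    norm_cast
    rw [hmod]
    rcases h8 with h | h | h | h <;> simp [h]
  rcases hN8 with hN8 | hN8 <;> rcases hv16 with ⟨-, hv16, h'⟩ | ⟨-, hv16, h'⟩
  · exact hJ (a := 0) (jacobiSym_two_of_one_mod_eight hN8) h' (by omega)
  · exact hJ (a := 0) (jacobiSym_two_of_one_mod_eight hN8) h' (by omega)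
  · exact hJ (a := 1) (jacobiSym_two_of_five_mod_eight hN8) h' (by omega)
  · exact hJ (a := 1) (jacobiSym_two_of_five_mod_eight hN8) h' (by omega)

theorem IsQuarticSymbol.mul_sum_of_three_mod_eight {k : Type} [Field k] {p : ℕ} [Fact p.Prime]
    [CharP k p] [Algebra (ZMod p) k] {I : k} (hI : I ^ 2 = -1) (hp : p % 8 = 3) (hp3 : p ≠ 3)
    (h10 : (10 : ZMod p) ≠ 0) {x y a b : ℤ} (ha : -a - b = x) (hb : a - b = 3 * y)
    (hXy : (x : ZMod p) ^ 2 = -10 * y ^ 2) (hy : (y : ZMod p) ≠ 0)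
    {Ψ : ℤ →* GaussianInt} (h : IsQuarticSymbol ⟨a, b⟩ Ψ)
    (hδ : (J(2 | (⟨a, b⟩ : GaussianInt).norm.natAbs) : ℤ) * Ψ p =
      (((-1) ^ (p / 8) : ℤ) : GaussianInt)) :
    10 * y * (2 * 3 ^ (p / 2) * ∑ k ∈ range (p / 4 + 1),
      (Nat.choose (4 * k) (2 * k) : ZMod p) / (-144 : ZMod p) ^ k) = 2 * (x : ZMod p) := by
  have hI' : (-I) ^ 2 = -1 := by rw [neg_sq, hI]
  have h2 := ZMod.two_pow_div_two p (by omega)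
  rw [if_neg (by omega)] at h2
  have h10k : (10 : k) ≠ 0 := by
    rw [← map_ofNat (algebraMap (ZMod p) k)]; exact (map_ne_zero _).2 h10
  have hyk : (y : k) ≠ 0 := by simpa using (map_ne_zero (algebraMap (ZMod p) k)).2 hy
  have hXk : (x : k) ^ 2 = -10 * y ^ 2 := by
    simpa only [map_mul, map_pow, map_neg, map_ofNat, map_intCast] using
      congrArg (algebraMap (ZMod p) k) hXy
  have h2k : (2 : k) ^ (p / 2) = -1 := by
    simpa only [map_pow, map_neg, map_ofNat, map_one] using congrArg (algebraMap (ZMod p) k) h2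
  have e1 := h.three_add_pow_of_three_mod_eight hI hp h10k ha hb hXk hyk hδ h2k
  have e2 := h.three_add_pow_of_three_mod_eight hI' hp h10k ha hb hXk hyk hδ h2k
  have e := two_mul_three_pow_mul_sum (show 2 * (p / 2) + 1 = p by omega) hp3 hI
  rw [← sub_eq_add_neg] at e2
  refine (algebraMap (ZMod p) k).injective ?_
  simp only [map_mul, map_pow, map_ofNat, map_intCast, map_sum, map_div₀, map_natCast, map_neg]
  rw [e]
  linear_combination (1 + 3 * I) * e1 + (1 - 3 * I) * e2 +
    9 * y * ((3 + I) ^ (p / 2) + (3 - I) ^ (p / 2)) * hI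

theorem sum_eq_of_three_mod_eight {p : ℕ} [Fact p.Prime] (hp : p % 8 = 3) {x y : ℤ}
    (hp3 : p ≠ 3) (h : (p : ℤ) = x ^ 2 + 10 * y ^ 2) (h4 : 4 ∣ x - y) :
    ∑ k ∈ range (p / 4 + 1), (Nat.choose (4 * k) (2 * k) : ZMod p) / (-144 : ZMod p) ^ k =
      (-1) ^ (p / 3) * (y / x) := by
  have hx : Odd x := by
    have : Odd (x ^ 2) := Int.odd_iff.2 (by omega)
    exact Int.odd_pow' two_ne_zero |>.1 this
  have hy : Odd y := by
    obtain ⟨t, ht⟩ := h4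
    rw [Int.odd_iff] at hx ⊢
    omega
  have hxy : IsCoprime x y := isCoprime_of_prime_eq Fact.out (a := 1) (b := 10) (by rw [h]; ring)
  have h' : x ^ 2 + 10 * y ^ 2 = 1 * p := by rw [h]; ring
  obtain ⟨a, b, ha, hb, hbe⟩ : ∃ a b : ℤ, -a - b = x ∧ a - b = 3 * y ∧ Even b := by
    obtain ⟨t, ht⟩ := h4
    refine ⟨y - 2 * t, -2 * (y + t), ?_, ?_, ⟨-(y + t), by ring⟩⟩ 
    · linear_combination -ht
    · ring
  have hN : 2 * (⟨a, b⟩ : GaussianInt).norm = x ^ 2 + 9 * y ^ 2 := by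
    rw [Zsqrtd.norm_def]
    linear_combination (-a - b + x) * ha + (a - b + 3 * y) * hb
  have hNodd : Odd (⟨a, b⟩ : GaussianInt).norm := by
    have := Int.sq_emod_eight_of_odd hx
    have := Int.sq_emod_eight_of_odd hy
    rw [Int.odd_iff]; omega
  obtain ⟨Ψ, hΨ⟩ := IsQuarticSymbol.exists_of_odd_norm hNodd hbe
  have hδ : (J(2 | (⟨a, b⟩ : GaussianInt).norm.natAbs) : ℤ) * Ψ p =
      (((-1) ^ (p / 8) : ℤ) : GaussianInt) := by
    rw [hΨ.periodic p (y ^ 2) ⟨2, by linear_combination h - hN⟩, map_pow, hΨ.sq, ← Int.cast_mul,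
      jacobiSym_two_mul_jacobiSym hp hy hxy h h4]
    rwa [Int.natCast_natAbs, abs_of_nonneg (GaussianInt.norm_nonneg _)]
  have hp2 : p ≠ 2 := by omega
  have hp5 : p ≠ 5 := by omega
  have h20 : (2 : ZMod p) ≠ 0 :=
    mod_cast natCast_ne_zero_of_prime_ne (K := ZMod p) Nat.prime_two hp2
  have h50 : (5 : ZMod p) ≠ 0 :=
    mod_cast natCast_ne_zero_of_prime_ne (K := ZMod p) Nat.prime_five hp5
  have h10 : (10 : ZMod p) ≠ 0 := by
    rw [show (10 : ZMod p) = 2 * 5 by norm_num]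
    exact mul_ne_zero h20 h50
  have hy0 : (y : ZMod p) ≠ 0 := intCast_ne_zero_of_isCoprime hxy h'
  have hXy : (x : ZMod p) ^ 2 = -10 * y ^ 2 := by
    have := congrArg (Int.cast (R := ZMod p)) h
    push_cast at this
    rw [CharP.cast_eq_zero] at this
    linear_combination -this
  have hx0 : (x : ZMod p) ≠ 0 := by
    intro h0
    rw [h0, zero_pow two_ne_zero] at hXy
    exact mul_ne_zero (neg_ne_zero.2 h10) (pow_ne_zero 2 hy0) hXy.symm
  have : CharP (AlgebraicClosure (ZMod p)) p := charP_of_injective_algebraMap' (ZMod p) p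
  obtain ⟨I, hI⟩ := IsAlgClosed.exists_pow_nat_eq (-1 : AlgebraicClosure (ZMod p)) two_pos
  have e := hΨ.mul_sum_of_three_mod_eight hI hp hp3 h10 ha hb hXy hy0 hδ
  have h3 := ZMod.three_pow_div_two p hp2 hp3
  rw [if_neg (by omega)] at h3
  rw [h3] at e
  have h33 : (-1 : ZMod p) ^ (p / 3) * (-1) ^ (p / 3) = 1 := by rw [← mul_pow]; simp
  rw [← mul_div_assoc, eq_div_iff hx0]
  refine mul_left_cancel₀ (mul_ne_zero h20 hx0) ?_
  set S := ∑ k ∈ range (p / 4 + 1), (Nat.choose (4 * k) (2 * k) : ZMod p) / (-144 : ZMod p) ^ k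
  linear_combination (-1) ^ (p / 3) * y * e + 2 * S * hXy + 20 * y ^ 2 * S * h33

end

theorem stmt8 (p : ℕ) [Fact p.Prime]
    (hp : p % 40 = 1 ∨ p % 40 = 9 ∨ p % 40 = 11 ∨ p % 40 = 13 ∨
      p % 40 = 19 ∨ p % 40 = 37) :
    ((p % 40 = 1 ∨ p % 40 = 9) → ∀ x y : ℤ, (p : ℤ) = x ^ 2 + 10 * y ^ 2 →
      Even y ∧
        (∑ k ∈ Finset.range (p / 4 + 1),
            (Nat.choose (4 * k) (2 * k) : ZMod p) / (-144 : ZMod p) ^ k)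
          = (-1 : ZMod p) ^ (((p : ℤ) / 3) + y / 2)) ∧
    ((p % 40 = 11 ∨ p % 40 = 19) → ∀ x y : ℤ, (p : ℤ) = x ^ 2 + 10 * y ^ 2 →
      (4 : ℤ) ∣ x - y →
        (∑ k ∈ Finset.range (p / 4 + 1),
            (Nat.choose (4 * k) (2 * k) : ZMod p) / (-144 : ZMod p) ^ k)
          = (-1 : ZMod p) ^ (p / 3) * ((y : ZMod p) / (x : ZMod p))) ∧
    ((p % 40 = 13 ∨ p % 40 = 37) → ∀ x y : ℤ, (p : ℤ) = 5 * x ^ 2 + 2 * y ^ 2 →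
      Even y ∧
        (∑ k ∈ Finset.range (p / 4 + 1),
            (Nat.choose (4 * k) (2 * k) : ZMod p) / (-144 : ZMod p) ^ k)
          = (-1 : ZMod p) ^ (((p : ℤ) / 3) + y / 2)) := by
  exact ⟨fun h x y hxy ↦ sum_eq_neg_one_zpow_of_one_mod_eight (by omega) hxy,
    fun h x y hxy h4 ↦ sum_eq_of_three_mod_eight (by omega) (by omega) hxy h4,
    fun h x y hxy ↦ sum_eq_neg_one_zpow_of_five_mod_eight (by omega) (by omega) hxy⟩
end

section
/- Let p be a prime with p ≡ 1 (mod 4), write p = c² + d² with c, d ∈ ℤ and d even, and let a be an integer with p ∤ (1 + 16a²)(1 − 16a²). Then, with (·|p) the Legendre symbol and (c − 4ad | 16a² + 1) the Jacobi symbol: 2·∑_{k=0}^{⌊p/8⌋} C(8k,4k)·a^{4k} ≡ (1 − 4a|p) + (c − 4ad | 16a² + 1) (mod p) if (1 − 16a²|p) = (1 + 16a²|p) = 1; ≡ (1 − 4a|p) (mod p) if (1 − 16a²|p) = 1 and (1 + 16a²|p) = −1; ≡ (c − 4ad | 16a² + 1) (mod p) if (1 − 16a²|p) = −1 and (1 +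 16a²|p) = 1; and ≡ 0 (mod p) if (1 − 16a²|p) = (1 + 16a²|p) = −1. -/
theorem Nat.cast_centralBinom_eq_choose_mul_neg_four_pow {p n : ℕ} [Fact p.Prime]
    (hn : p = 2 * n + 1) {m : ℕ} (hm : m < p) :
    (m.centralBinom : ZMod p) = n.choose m * (-4) ^ m := by
  induction m with
  | zero => simp
  | succ m ih =>
    have h0 : ((m + 1 : ℕ) : ZMod p) ≠ 0 := by
      rw [Ne, ZMod.natCast_eq_zero_iff]
      exact Nat.not_dvd_of_pos_of_lt m.succ_pos hm
    have hp0 : (2 * n + 1 : ZMod p) = 0 := by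
      exact_mod_cast (ZMod.natCast_eq_zero_iff (2 * n + 1) p).mpr hn.dvd
    have hc := congrArg (Nat.cast (R := ZMod p)) (Nat.succ_mul_centralBinom_succ m)
    have hs : (n.choose (m + 1) : ZMod p) * (m + 1) = n.choose m * (n - m) := by
      rcases le_or_gt m n with h | h
      · have := congrArg (Nat.cast (R := ZMod p)) (Nat.choose_succ_right_eq n m)
        push_cast [h] at this
        exact this
      · simp [Nat.choose_eq_zero_of_lt h, Nat.choose_eq_zero_of_lt (h.trans m.lt_succ_self)]
    apply mul_left_cancel₀ h0
    push_cast at hc ⊢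
    rw [hc, ih (by omega)]
    linear_combination 4 * (-4) ^ m * hs + 2 * (n.choose m * (-4) ^ m) * hp0

theorem Finset.sum_range_four_mul {M : Type*} [AddCommMonoid M] (f : ℕ → M) (K : ℕ) :
    ∑ j ∈ range (4 * K), f j =
      ∑ k ∈ range K, (f (4 * k) + f (4 * k + 1) + f (4 * k + 2) + f (4 * k + 3)) := by
  induction K with
  | zero => simp
  | succ K ih =>
    rw [mul_add_one, sum_range_succ _ K, ← ih]
    simp only [sum_range_succ, add_assoc]

theorem four_mul_sum_choose_four_mul {R : Type*} [CommRing R] {i : R} (hi : i ^ 2 = -1) (x : R)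
    (n : ℕ) :
    4 * ∑ k ∈ Finset.range (n / 4 + 1), (n.choose (4 * k) : R) * x ^ (4 * k) =
      (1 + x) ^ n + (1 - x) ^ n + (1 + i * x) ^ n + (1 - i * x) ^ n := by
  have expand (y : R) : (1 + y) ^ n =
      ∑ j ∈ Finset.range (4 * (n / 4 + 1)), (n.choose j : R) * y ^ j := by
    rw [add_comm, add_pow]
    refine Finset.sum_subset_zero_on_sdiff (Finset.range_mono (by omega)) (fun j hj => ?_)
      fun j _ => by simp [mul_comm]
    simp only [Finset.mem_sdiff, Finset.mem_range] at hj
    simp [Nat.choose_eq_zero_of_lt (show n < j by omega)]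
  have hi4 (k : ℕ) : i ^ (4 * k) = 1 := by
    rw [pow_mul, show i ^ 4 = (i ^ 2) ^ 2 by ring, hi]; simp
  have hi3 : i ^ 3 = -i := by rw [pow_succ, hi]; ring
  simp only [sub_eq_add_neg, expand, Finset.sum_range_four_mul, ← Finset.sum_add_distrib,
    Finset.mul_sum]
  refine Finset.sum_congr rfl fun k _ => ?_
  have hneg (y : R) : (-y) ^ (4 * k) = y ^ (4 * k) := Even.neg_pow ⟨2 * k, by ring⟩ y
  simp only [pow_add, hneg, mul_pow, hi4, neg_sq, hi, hi3, Odd.neg_pow (by decide : Odd 3), pow_one]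
  ring

theorem jacobiSym.eq_natAbs_of_mod_four_eq_one {e : ℤ} (he : Odd e) {m : ℕ} (hm : m % 4 = 1) :
    jacobiSym e m = jacobiSym m e.natAbs := by
  rw [jacobiSym.quadratic_reciprocity_one_mod_four hm (Int.natAbs_odd.mpr he)]
  rcases Int.natAbs_eq e with h | h
  · rw [← h]
  · nth_rw 1 [h]
    rw [jacobiSym.neg _ (Nat.odd_iff.mpr (by omega)), ZMod.χ₄_nat_one_mod_four hm, one_mul]

theorem jacobiSym_eq_of_dvd_sq_add_mul {e r : ℤ} (he : Odd e) {m n : ℕ} (hm : m % 4 = 1)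
    (hn : n % 4 = 1) (hco : IsCoprime e r) (h : e ∣ m * n - r ^ 2) :
    jacobiSym e m = jacobiSym e n := by
  rw [jacobiSym.eq_natAbs_of_mod_four_eq_one he hm, jacobiSym.eq_natAbs_of_mod_four_eq_one he hn]
  have hsq : jacobiSym (m * n) e.natAbs = 1 := by
    rw [jacobiSym.mod_left' (a₂ := r ^ 2), jacobiSym.sq_one']
    · simpa only [Int.gcd, Int.natAbs_natCast] using Int.isCoprime_iff_gcd_eq_one.mp hco.symm
    · exact (Int.modEq_iff_dvd.mpr (Int.natAbs_dvd.mpr h)).symm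
  rw [jacobiSym.mul_left] at hsq
  rcases Int.mul_eq_one_iff_eq_one_or_neg_one.mp hsq with ⟨h1, h2⟩ | ⟨h1, h2⟩ <;> rw [h1, h2]

theorem isCoprime_of_prime_eq_sq_add_sq {p : ℕ} (hp : p.Prime) {c d : ℤ}
    (hcd : (p : ℤ) = c ^ 2 + d ^ 2) : IsCoprime c d := by
  refine IsRelPrime.isCoprime fun x hc hd => (Nat.prime_iff_prime_int.mp hp).squarefree x ?_
  rw [hcd, sq, sq]
  exact dvd_add (mul_dvd_mul hc hc) (mul_dvd_mul hd hd)

theorem legendreSym_eq_one_of_eq_sq_add_sq {p : ℕ} [Fact p.Prime] (hp : p % 4 = 1) {c d : ℤ}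
    (hcd : (p : ℤ) = c ^ 2 + d ^ 2) (hc : Odd c) : legendreSym p c = 1 := by
  rw [jacobiSym.legendreSym.to_jacobiSym, jacobiSym_eq_of_dvd_sq_add_mul (n := 1) hc hp rfl
    (isCoprime_of_prime_eq_sq_add_sq Fact.out hcd), jacobiSym.one_right]
  exact ⟨c, by rw [hcd]; push_cast; ring⟩

theorem legendreSym_sub_eq_jacobiSym {p : ℕ} [Fact p.Prime] (hp : p % 4 = 1) {c d : ℤ}
    (hcd : (p : ℤ) = c ^ 2 + d ^ 2) (hc : Odd c) {a : ℤ} (ha : ¬ (p : ℤ) ∣ 1 + 16 * a ^ 2) :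
    legendreSym p (c - 4 * a * d) = jacobiSym (c - 4 * a * d) (16 * a ^ 2 + 1).toNat := by
  have hm : ((16 * a ^ 2 + 1).toNat : ℤ) = 16 * a ^ 2 + 1 := Int.toNat_of_nonneg (by positivity)
  have he : Odd (c - 4 * a * d) := hc.sub_even ⟨2 * a * d, by ring⟩
  rw [jacobiSym.legendreSym.to_jacobiSym]
  refine jacobiSym_eq_of_dvd_sq_add_mul (r := d + 4 * a * c) he hp (by omega) ?_ ?_
  · obtain ⟨x, y, hxy⟩ := isCoprime_of_prime_eq_sq_add_sq Fact.out hcd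
    obtain ⟨u, v, huv⟩ :=
      (Nat.prime_iff_prime_int.mp (Fact.out : p.Prime)).coprime_iff_not_dvd.mpr ha
    refine ⟨u * c + v * (x - 4 * a * y), u * d + v * (4 * a * x + y), ?_⟩
    linear_combination huv - u * hcd + v * (1 + 16 * a ^ 2) * hxy
  · rw [hm, hcd]
    exact ⟨c - 4 * a * d, by ring⟩

theorem stmt11 (p : ℕ) [Fact p.Prime] (hp : p % 4 = 1) (c d : ℤ)
    (hcd : (p : ℤ) = c ^ 2 + d ^ 2) (hd : Even d) (a : ℤ)
    (ha : ¬ (p : ℤ) ∣ (1 + 16 * a ^ 2) * (1 - 16 * a ^ 2)) :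
    (legendreSym p (1 - 16 * a ^ 2) = 1 → legendreSym p (1 + 16 * a ^ 2) = 1 →
      2 * (∑ k ∈ Finset.range (p / 8 + 1),
          (Nat.choose (8 * k) (4 * k) : ZMod p) * (a : ZMod p) ^ (4 * k))
        = (legendreSym p (1 - 4 * a) : ZMod p) +
            (jacobiSym (c - 4 * a * d) (16 * a ^ 2 + 1).toNat : ZMod p)) ∧
    (legendreSym p (1 - 16 * a ^ 2) = 1 → legendreSym p (1 + 16 * a ^ 2) = -1 →
      2 * (∑ k ∈ Finset.range (p / 8 + 1),
          (Nat.choose (8 * k) (4 * k) : ZMod p) * (a : ZMod p) ^ (4 * k))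
        = (legendreSym p (1 - 4 * a) : ZMod p)) ∧
    (legendreSym p (1 - 16 * a ^ 2) = -1 → legendreSym p (1 + 16 * a ^ 2) = 1 →
      2 * (∑ k ∈ Finset.range (p / 8 + 1),
          (Nat.choose (8 * k) (4 * k) : ZMod p) * (a : ZMod p) ^ (4 * k))
        = (jacobiSym (c - 4 * a * d) (16 * a ^ 2 + 1).toNat : ZMod p)) ∧
    (legendreSym p (1 - 16 * a ^ 2) = -1 → legendreSym p (1 + 16 * a ^ 2) = -1 →
      2 * (∑ k ∈ Finset.range (p / 8 + 1),
          (Nat.choose (8 * k) (4 * k) : ZMod p) * (a : ZMod p) ^ (4 * k)) = 0) := by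
  have hpr : p.Prime := Fact.out
  have hodd : Odd (p : ℤ) := by exact_mod_cast Nat.odd_iff.mpr (show p % 2 = 1 by omega)
  have hc : Odd c := by
    rw [hcd] at hodd
    by_contra h
    exact Int.not_odd_iff_even.mpr
      (((Int.not_odd_iff_even.mp h).pow_of_ne_zero two_ne_zero).add
        (hd.pow_of_ne_zero two_ne_zero)) hodd
  have hlc := legendreSym_eq_one_of_eq_sq_add_sq hp hcd hc
  rw [← legendreSym_sub_eq_jacobiSym hp hcd hc fun h => ha (h.mul_right _)]
  have hc0 : (c : ZMod p) ≠ 0 := fun h => by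
    rw [(legendreSym.eq_zero_iff p c).mpr h] at hlc
    exact zero_ne_one hlc
  have hcd0 : (c : ZMod p) ^ 2 + (d : ZMod p) ^ 2 = 0 := by
    have := congrArg (Int.cast (R := ZMod p)) hcd
    push_cast at this
    rw [← this, ZMod.natCast_self]
  set i : ZMod p := -d / c with hi_def
  have hi : i ^ 2 = -1 := by
    rw [hi_def]
    field_simp
    linear_combination hcd0
  have hcn : (c : ZMod p) ^ (p / 2) = 1 := by rw [← legendreSym.eq_pow, hlc, Int.cast_one]
  have hic : (c : ZMod p) * (1 + i * (4 * a)) = c - 4 * a * d := by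
    rw [hi_def]
    field_simp
    ring
  have hsum : 4 * ∑ k ∈ Finset.range (p / 8 + 1),
      (Nat.choose (8 * k) (4 * k) : ZMod p) * (a : ZMod p) ^ (4 * k) =
      (1 + 4 * a) ^ (p / 2) + (1 - 4 * a) ^ (p / 2) + (1 + i * (4 * a)) ^ (p / 2) +
        (1 - i * (4 * a)) ^ (p / 2) := by
    rw [← four_mul_sum_choose_four_mul hi, Nat.div_div_eq_div_mul]
    congr 1
    refine Finset.sum_congr rfl fun k hk => ?_
    rw [Finset.mem_range] at hk
    have h := Nat.cast_centralBinom_eq_choose_mul_neg_four_pow (p := p) (n := p / 2) (m := 4 * k)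
      (by omega) (by omega)
    rw [Nat.centralBinom, show 2 * (4 * k) = 8 * k by ring] at h
    rw [h, mul_pow, Even.neg_pow ⟨2 * k, by ring⟩, mul_assoc]
  have h2 : (2 : ZMod p) ≠ 0 := by
    intro h
    have := (ZMod.natCast_eq_zero_iff 2 p).mp (by exact_mod_cast h)
    have := Nat.le_of_dvd two_pos this
    have := hpr.two_le
    omega
  have hre : (1 - 16 * a ^ 2 : ZMod p) ^ (p / 2) =
      (1 + 4 * a) ^ (p / 2) * (1 - 4 * a) ^ (p / 2) := by rw [← mul_pow]; ring
  have him : (1 + 16 * a ^ 2 : ZMod p) ^ (p / 2) =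
      (1 + i * (4 * a)) ^ (p / 2) * (1 - i * (4 * a)) ^ (p / 2) := by
    rw [← mul_pow]
    congr 1
    linear_combination 16 * (a : ZMod p) ^ 2 * hi
  have hE : ((legendreSym p (c - 4 * a * d) : ℤ) : ZMod p) = (1 + i * (4 * a)) ^ (p / 2) := by
    rw [legendreSym.eq_pow]
    push_cast
    rw [← hic, mul_pow, hcn, one_mul]
  have hquad {x y s : ZMod p} (h : s = x ^ (p / 2) * y ^ (p / 2)) (hs : s ≠ 0) :
      x ^ (p / 2) = s * y ^ (p / 2) := by
    have hy : y ≠ 0 := by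
      rintro rfl
      rw [zero_pow (by have := hpr.two_le; omega), mul_zero] at h
      exact hs h
    rcases ZMod.pow_div_two_eq_neg_one_or_one p hy with h' | h' <;> rw [h, h'] <;> ring
  have key {s t : ℤ} (hs0 : (s : ZMod p) ≠ 0) (ht0 : (t : ZMod p) ≠ 0)
      (hs : legendreSym p (1 - 16 * a ^ 2) = s) (ht : legendreSym p (1 + 16 * a ^ 2) = t) :
      2 * (2 * ∑ k ∈ Finset.range (p / 8 + 1),
        (Nat.choose (8 * k) (4 * k) : ZMod p) * (a : ZMod p) ^ (4 * k)) =
      (s + 1) * (legendreSym p (1 - 4 * a) : ZMod p) +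
        (t + 1) * (legendreSym p (c - 4 * a * d) : ZMod p) := by
    have hs' := legendreSym.eq_pow p (1 - 16 * a ^ 2)
    have ht' := legendreSym.eq_pow p (1 + 16 * a ^ 2)
    have hB := legendreSym.eq_pow p (1 - 4 * a)
    push_cast at hs' ht' hB
    rw [hs, hre] at hs'
    rw [ht, him, mul_comm] at ht'
    have hA := hquad hs' hs0
    have hF := hquad ht' ht0
    rw [hE, hB]
    linear_combination hsum + hA + hF
  refine ⟨fun hs ht => ?_, fun hs ht => ?_, fun hs ht => ?_, fun hs ht => ?_⟩ <;>
    refine mul_left_cancel₀ h2 ((key (by simp) (by simp) hs ht).trans ?_) <;> push_cast <;> ring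
end

section
/- Let p > 3 be a prime and let a, b be integers with p ∤ ab. Then, with the congruence interpreted in ℤ/pℤ: ∑_{k=0}^{⌊p/3⌋} C(3k,k)·(b^{2k}/a^k) ≡ (−3a)^{−⌊p/3⌋}·U_{2⌊p/3⌋+1}(9b, 3a) (mod p). -/
/-- The Lucas sequence `U_n(P,Q)`: `U_0 = 0`, `U_1 = 1`,
`U_{n+1} = P·U_n − Q·U_{n−1}`. -/
def lucasU (P Q : ℤ) : ℕ → ℤ
  | 0 => 0
  | 1 => 1
  | n + 2 => P * lucasU P Q (n + 1) - Q * lucasU P Q n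

open Finset in
/-- Explicit binomial expansions of the odd- and even-indexed terms of a Lucas sequence. -/
theorem lucasU_eq_sum_choose (P Q : ℤ) (n : ℕ) :
    lucasU P Q (2 * n + 1) =
        ∑ k ∈ range (n + 1), ((n + k).choose (2 * k) : ℤ) * (-Q) ^ (n - k) * P ^ (2 * k) ∧
      lucasU P Q (2 * n + 2) =
        ∑ k ∈ range (n + 1),
          ((n + 1 + k).choose (2 * k + 1) : ℤ) * (-Q) ^ (n - k) * P ^ (2 * k + 1) := by
  induction n with
  | zero => simp [lucasU]
  | succ n ih =>
    obtain ⟨hodd, heven⟩ := ih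
    have hodd' : lucasU P Q (2 * (n + 1) + 1) =
        ∑ k ∈ range (n + 1 + 1),
          ((n + 1 + k).choose (2 * k) : ℤ) * (-Q) ^ (n + 1 - k) * P ^ (2 * k) := by
      have hrec : lucasU P Q (2 * (n + 1) + 1) =
          P * lucasU P Q (2 * n + 2) - Q * lucasU P Q (2 * n + 1) := rfl
      have hshift : ∑ k ∈ range (n + 1),
            ((n + k).choose (2 * k) : ℤ) * (-Q) ^ (n + 1 - k) * P ^ (2 * k) =
          ∑ k ∈ range (n + 1), ((n + (k + 1)).choose (2 * (k + 1)) : ℤ) *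
            (-Q) ^ (n - k) * P ^ (2 * (k + 1)) + (-Q) ^ (n + 1) := by
        have h := sum_range_succ' (fun k ↦
          ((n + k).choose (2 * k) : ℤ) * (-Q) ^ (n + 1 - k) * P ^ (2 * k)) (n + 1)
        rw [sum_range_succ, Nat.choose_eq_zero_of_lt (by omega : n + (n + 1) < 2 * (n + 1))] at h
        simpa using h
      have hQ : -Q * lucasU P Q (2 * n + 1) = ∑ k ∈ range (n + 1),
            ((n + k).choose (2 * k) : ℤ) * (-Q) ^ (n + 1 - k) * P ^ (2 * k) := by
        rw [hodd, mul_sum]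
        refine sum_congr rfl fun k hk ↦ ?_
        rw [Nat.sub_add_comm (Nat.lt_succ_iff.mp (mem_range.mp hk)), pow_succ]
        ring
      rw [hrec, sub_eq_add_neg, ← neg_mul, hQ, hshift, heven, mul_sum, sum_range_succ' _ (n + 1),
        ← add_assoc, ← sum_add_distrib]
      congr 1
      · refine sum_congr rfl fun k _ ↦ ?_
        rw [show n + 1 + (k + 1) = n + 1 + k + 1 by ring, show 2 * (k + 1) = 2 * k + 1 + 1 by ring,
          Nat.choose_succ_succ, Nat.add_sub_add_right, show n + (k + 1) = n + 1 + k by ring]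
        push_cast
        ring
      · simp
    refine ⟨hodd', ?_⟩
    have hrec : lucasU P Q (2 * (n + 1) + 2) =
        P * lucasU P Q (2 * (n + 1) + 1) - Q * lucasU P Q (2 * n + 2) := rfl
    have hQ : -Q * lucasU P Q (2 * n + 2) = ∑ k ∈ range (n + 1 + 1),
          ((n + 1 + k).choose (2 * k + 1) : ℤ) * (-Q) ^ (n + 1 - k) * P ^ (2 * k + 1) := by
      rw [heven, sum_range_succ _ (n + 1),
        Nat.choose_eq_zero_of_lt (by omega : n + 1 + (n + 1) < 2 * (n + 1) + 1), mul_sum]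
      simp only [Nat.cast_zero, zero_mul, add_zero]
      refine sum_congr rfl fun k hk ↦ ?_
      rw [Nat.sub_add_comm (Nat.lt_succ_iff.mp (mem_range.mp hk)), pow_succ]
      ring
    rw [hrec, sub_eq_add_neg, ← neg_mul, hQ, hodd', mul_sum, ← sum_add_distrib]
    refine sum_congr rfl fun k _ ↦ ?_
    rw [show n + 1 + 1 + k = n + 1 + k + 1 by ring, Nat.choose_succ_succ]
    push_cast
    ring

open Nat in
theorem choose_three_mul_succ (k : ℕ) :
    (3 * (k + 1)).choose (k + 1) * ((2 * k + 2) * (2 * k + 1)) =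
      (3 * k).choose k * (3 * ((3 * k + 2) * (3 * k + 1))) := by
  have h₀ := Nat.add_choose_mul_factorial_mul_factorial (2 * k) k
  have h₁ := Nat.add_choose_mul_factorial_mul_factorial (2 * k + 2) (k + 1)
  rw [show 2 * k + k = 3 * k by ring] at h₀
  rw [show 2 * k + 2 + (k + 1) = 3 * k + 2 + 1 by ring] at h₁
  simp only [Nat.factorial_succ] at h₁
  rw [← h₀] at h₁
  rw [show 3 * (k + 1) = 3 * k + 2 + 1 by ring]
  have hpos : 0 < (k + 1) * (k ! * (2 * k)!) := by positivity
  refine Nat.eq_of_mul_eq_mul_right hpos ?_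
  linarith

open Nat in
theorem choose_add_two_mul_succ (k d : ℕ) :
    (k + 1 + d + (k + 1)).choose (2 * (k + 1)) * ((2 * k + 2) * (2 * k + 1)) =
      (k + 1 + d + k).choose (2 * k) * ((k + 1 + d + k + 1) * (d + 1)) := by
  have h₀ := Nat.add_choose_mul_factorial_mul_factorial (d + 1) (2 * k)
  have h₁ := Nat.add_choose_mul_factorial_mul_factorial d (2 * k + 2)
  rw [show d + 1 + 2 * k = k + 1 + d + k by ring] at h₀
  rw [show d + (2 * k + 2) = k + 1 + d + k + 1 by ring, Nat.factorial_succ (k + 1 + d + k)] at h₁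
  rw [← h₀] at h₁
  simp only [Nat.factorial_succ] at h₁
  rw [show k + 1 + d + (k + 1) = k + 1 + d + k + 1 by ring, show 2 * (k + 1) = 2 * k + 2 by ring]
  have hpos : 0 < (2 * k)! * d ! := by positivity
  refine Nat.eq_of_mul_eq_mul_right hpos ?_
  linarith

/-- Modulo a prime `p > 3`, the binomials `C(3k, k)` with `k ≤ ⌊p/3⌋` are, up to powers of `-27`,
the coefficients of a Lucas polynomial. -/
theorem choose_three_mul_eq_zmod (p : ℕ) [hpp : Fact p.Prime] (hp : 3 < p) {k : ℕ}
    (hk : k ≤ p / 3) :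
    ((3 * k).choose k : ZMod p) = ((p / 3 + k).choose (2 * k) : ZMod p) * (-27) ^ k := by
  induction k with
  | zero => simp
  | succ k ih =>
    have ih := ih (by omega)
    obtain ⟨d, hd⟩ := Nat.exists_eq_add_of_le hk
    have hcast {m : ℕ} (h0 : 0 < m) (hm : m < p) : (m : ZMod p) ≠ 0 := fun h ↦
      Nat.not_le_of_lt hm (Nat.le_of_dvd h0 ((ZMod.natCast_eq_zero_iff m p).mp h))
    have h2 : ((2 * k + 2 : ℕ) : ZMod p) ≠ 0 := hcast (by omega) (by omega)
    have h1 : ((2 * k + 1 : ℕ) : ZMod p) ≠ 0 := hcast (by omega) (by omega)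
    have hmod : (3 * ((k + 1 + d : ℕ) : ZMod p) + 1) * (3 * ((k + 1 + d : ℕ) : ZMod p) + 2) = 0 := by
      have h3 : ¬ 3 ∣ p := fun h ↦ by
        have := (Nat.prime_dvd_prime_iff_eq Nat.prime_three hpp.out).mp h
        omega
      obtain h | h : 3 * (k + 1 + d) + 1 = p ∨ 3 * (k + 1 + d) + 2 = p := by omega
      all_goals
        have h' := congrArg (Nat.cast : ℕ → ZMod p) h
        push_cast at h' ⊢
        rw [h']
        simp
    have hthree := congrArg (Nat.cast : ℕ → ZMod p) (choose_three_mul_succ k)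
    have hadd := congrArg (Nat.cast : ℕ → ZMod p) (choose_add_two_mul_succ k d)
    rw [hd] at ih ⊢
    refine mul_right_cancel₀ (mul_ne_zero h2 h1) ?_
    push_cast at hthree hadd hmod ih ⊢
    rw [pow_succ]
    linear_combination hthree - (-27) ^ k * (-27) * hadd + 3 * ((3 * k + 2) * (3 * k + 1)) * ih
      + 3 * ((k + 1 + d + k).choose (2 * k) : ZMod p) * (-27) ^ k * hmod

theorem stmt12 (p : ℕ) [Fact p.Prime] (hp : 3 < p) (a b : ℤ)
    (hab : ¬ (p : ℤ) ∣ a * b) :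
    (∑ k ∈ Finset.range (p / 3 + 1),
        (Nat.choose (3 * k) k : ZMod p) * (b : ZMod p) ^ (2 * k) / (a : ZMod p) ^ k)
      = ((-3 * (a : ZMod p)) ^ (p / 3))⁻¹ *
          (lucasU (9 * b) (3 * a) (2 * (p / 3) + 1) : ZMod p) := by
  have ha : (a : ZMod p) ≠ 0 := fun h ↦
    hab (((ZMod.intCast_zmod_eq_zero_iff_dvd a p).mp h).mul_right b)
  have h3 : (-3 : ZMod p) ≠ 0 := by
    refine neg_ne_zero.mpr fun h ↦ ?_
    exact absurd (Nat.le_of_dvd three_pos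
      ((ZMod.natCast_eq_zero_iff 3 p).mp (by exact_mod_cast h))) (by omega)
  rw [(lucasU_eq_sum_choose (9 * b) (3 * a) (p / 3)).1]
  push_cast
  rw [Finset.mul_sum]
  refine Finset.sum_congr rfl fun k hk ↦ ?_
  have hk' : k ≤ p / 3 := Nat.lt_succ_iff.mp (Finset.mem_range.mp hk)
  have hpow : (-3 * (a : ZMod p)) ^ (p / 3) =
      (-3 * (a : ZMod p)) ^ (p / 3 - k) * (-3 * (a : ZMod p)) ^ k := by
    rw [← pow_add, Nat.sub_add_cancel hk']
  have hne := mul_ne_zero h3 ha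
  have h81 : (81 : ZMod p) ^ k = (-27) ^ k * (-3) ^ k := by
    rw [← mul_pow]
    norm_num
  rw [choose_three_mul_eq_zmod p hp hk', eq_inv_mul_iff_mul_eq₀ (pow_ne_zero _ hne), hpow,
    ← neg_mul, mul_pow (-3 : ZMod p) (a : ZMod p) k, mul_pow (9 : ZMod p), pow_mul (9 : ZMod p),
    show (9 : ZMod p) ^ 2 = 81 by norm_num, h81]
  field_simp
end

section
/- Let p > 3 be a prime. Then, with the congruence interpreted in ℤ/pℤ: ∑_{k=0}^{⌊p/3⌋} C(3k,k)/27^k ≡ 1 (mod p) if p ≡ ±1 (mod 9); ≡ −1 (mod p) if p ≡ ±2 (mod 9); and ≡ 0 (mod p) if p ≡ ±4 (mod 9). -/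
open Finset in
/-- The alternating sum `∑ (-1) ^ k * C(n + k, 2k)` satisfies a first order recurrence coupled with
`∑ (-1) ^ k * C(n + 1 + k, 2k + 1)`. -/
theorem sum_alternating_choose_even_succ (n : ℕ) :
    ∑ k ∈ range (n + 2), (-1 : ℤ) ^ k * ((n + 1 + k).choose (2 * k) : ℤ) =
      ∑ k ∈ range (n + 1), (-1 : ℤ) ^ k * ((n + k).choose (2 * k) : ℤ) -
      ∑ k ∈ range (n + 1), (-1 : ℤ) ^ k * ((n + 1 + k).choose (2 * k + 1) : ℤ) := by
  have h (k : ℕ) : (-1 : ℤ) ^ (k + 1) * ((n + 1 + (k + 1)).choose (2 * (k + 1)) : ℤ) =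
      (-1) ^ (k + 1) * ((n + (k + 1)).choose (2 * (k + 1)) : ℤ) -
        (-1) ^ k * ((n + 1 + k).choose (2 * k + 1) : ℤ) := by
    rw [show n + 1 + (k + 1) = (n + 1 + k) + 1 by ring, show 2 * (k + 1) = 2 * k + 1 + 1 by ring,
      Nat.choose_succ_succ, show n + (k + 1) = n + 1 + k by ring]
    push_cast
    ring
  have htop : ∑ k ∈ range (n + 1), (-1 : ℤ) ^ k * ((n + k).choose (2 * k) : ℤ) =
      ∑ k ∈ range (n + 2), (-1 : ℤ) ^ k * ((n + k).choose (2 * k) : ℤ) := by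
    rw [sum_range_succ _ (n + 1), Nat.choose_eq_zero_of_lt (by lia : n + (n + 1) < 2 * (n + 1))]
    simp
  rw [htop, sum_range_succ', sum_range_succ' _ (n + 1)]
  simp only [h, sum_sub_distrib, Nat.mul_zero, Nat.choose_zero_right]
  ring

open Finset in
theorem sum_alternating_choose_odd_succ (n : ℕ) :
    ∑ k ∈ range (n + 2), (-1 : ℤ) ^ k * ((n + 2 + k).choose (2 * k + 1) : ℤ) =
      ∑ k ∈ range (n + 2), (-1 : ℤ) ^ k * ((n + 1 + k).choose (2 * k) : ℤ) +
      ∑ k ∈ range (n + 1), (-1 : ℤ) ^ k * ((n + 1 + k).choose (2 * k + 1) : ℤ) := by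
  have h (k : ℕ) : ((n + 2 + k).choose (2 * k + 1) : ℤ) =
      (n + 1 + k).choose (2 * k) + (n + 1 + k).choose (2 * k + 1) := by
    rw [show n + 2 + k = (n + 1 + k) + 1 by ring, Nat.choose_succ_succ]
    push_cast
    rfl
  have htop : ∑ k ∈ range (n + 1), (-1 : ℤ) ^ k * ((n + 1 + k).choose (2 * k + 1) : ℤ) =
      ∑ k ∈ range (n + 2), (-1 : ℤ) ^ k * ((n + 1 + k).choose (2 * k + 1) : ℤ) := by
    rw [sum_range_succ _ (n + 1),
      Nat.choose_eq_zero_of_lt (by lia : n + 1 + (n + 1) < 2 * (n + 1) + 1)]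
    simp
  rw [htop, ← sum_add_distrib]
  exact sum_congr rfl fun k _ => by rw [h]; ring

open Finset in
/-- The sum `∑ (-1) ^ k * C(n + k, 2k)` is periodic in `n` with period `6`. -/
theorem sum_alternating_choose_even_add_six (n : ℕ) :
    ∑ k ∈ range (n + 6 + 1), (-1 : ℤ) ^ k * ((n + 6 + k).choose (2 * k) : ℤ) =
      ∑ k ∈ range (n + 1), (-1 : ℤ) ^ k * ((n + k).choose (2 * k) : ℤ) := by
  have hS (m : ℕ) := sum_alternating_choose_even_succ (n + m)
  have hT (m : ℕ) := sum_alternating_choose_odd_succ (n + m)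
  have h0 := hS 0
  have h1 := hS 1
  have h2 := hS 2
  have h3 := hS 3
  have h4 := hS 4
  have h5 := hS 5
  have g0 := hT 0
  have g1 := hT 1
  have g2 := hT 2
  have g3 := hT 3
  have g4 := hT 4
  simp only [add_assoc n, Nat.reduceAdd, add_zero] at *
  linarith

open Finset in
theorem sum_alternating_choose_even_eq_mod_six (n : ℕ) :
    ∑ k ∈ range (n + 1), (-1 : ℤ) ^ k * ((n + k).choose (2 * k) : ℤ) =
      ∑ k ∈ range (n % 6 + 1), (-1 : ℤ) ^ k * ((n % 6 + k).choose (2 * k) : ℤ) := by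
  have h : Function.Periodic
      (fun n => ∑ k ∈ range (n + 1), (-1 : ℤ) ^ k * ((n + k).choose (2 * k) : ℤ)) 6 :=
    sum_alternating_choose_even_add_six
  exact (h.map_mod_nat n).symm

theorem choose_three_mul_succ_mul (k : ℕ) :
    (3 * (k + 1)).choose (k + 1) * ((2 * k + 1) * (2 * k + 2)) =
      3 * ((3 * k + 1) * (3 * k + 2)) * (3 * k).choose k := by
  have h1 := Nat.add_choose_mul_factorial_mul_factorial (2 * k) k
  have h2 := Nat.add_choose_mul_factorial_mul_factorial (2 * k + 2) (k + 1)
  rw [show 2 * k + k = 3 * k by ring] at h1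
  rw [show 2 * k + 2 + (k + 1) = 3 * k + 2 + 1 by ring] at h2
  simp only [Nat.factorial_succ] at h2
  rw [show 3 * (k + 1) = 3 * k + 2 + 1 by ring]
  have hpos : 0 < (k + 1) * ((2 * k).factorial * k.factorial) := by positivity
  refine Nat.eq_of_mul_eq_mul_right hpos ?_
  linear_combination h2 - (3 * k + 3) * ((3 * k + 1) * (3 * k + 2)) * h1

theorem choose_add_succ_two_mul_succ_mul (n k : ℕ) :
    (n + (k + 1)).choose (2 * (k + 1)) * ((2 * k + 1) * (2 * k + 2)) =
      (n + k + 1) * (n - k) * (n + k).choose (2 * k) := by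
  have h1 := Nat.add_one_mul_choose_eq (n + k) (2 * k + 1)
  have h2 := Nat.choose_succ_right_eq (n + k) (2 * k)
  rw [show n + k - 2 * k = n - k by lia] at h2
  rw [show n + (k + 1) = n + k + 1 by ring, show 2 * (k + 1) = 2 * k + 1 + 1 by ring]
  linear_combination (n + k + 1) * h2 - (2 * k + 1) * h1

theorem choose_three_mul_eq_of_quadratic {p n k : ℕ} [Fact p.Prime] (hn : 2 * n < p)
    (h : 9 * (n : ZMod p) ^ 2 + 9 * n + 2 = 0) (hk : k ≤ n) :
    ((3 * k).choose k : ZMod p) = 27 ^ k * ((-1) ^ k * (n + k).choose (2 * k)) := by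
  induction k with
  | zero => simp
  | succ k ih =>
    have ih := ih (by lia)
    have ne {m : ℕ} (h0 : 0 < m) (hm : m < p) : (m : ZMod p) ≠ 0 := by
      rw [Ne, ZMod.natCast_eq_zero_iff]
      exact Nat.not_dvd_of_pos_of_lt h0 hm
    have hne : (2 * (k : ZMod p) + 1) * (2 * k + 2) ≠ 0 := by
      refine mul_ne_zero ?_ ?_
      · exact_mod_cast ne (by lia : 0 < 2 * k + 1) (by lia)
      · exact_mod_cast ne (by lia : 0 < 2 * k + 2) (by lia)
    have h1 := congrArg (Nat.cast (R := ZMod p)) (choose_three_mul_succ_mul k)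
    have h2 := congrArg (Nat.cast (R := ZMod p))
      (choose_add_succ_two_mul_succ_mul n k)
    rw [Nat.cast_mul] at h1 h2
    push_cast [Nat.cast_sub (by lia : k ≤ n)] at h1 h2
    refine mul_right_cancel₀ hne ?_
    rw [ih] at h1
    linear_combination h1 + 27 ^ (k + 1) * (-1) ^ k * h2 +
      3 * 27 ^ k * (-1) ^ k * ((n + k).choose (2 * k) : ZMod p) * h

open Finset in
theorem sum_choose_three_mul_div_pow {p : ℕ} [Fact p.Prime] (hp : 3 < p) :
    ∑ k ∈ range (p / 3 + 1), ((3 * k).choose k : ZMod p) / 27 ^ k =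
      ((∑ k ∈ range (p / 3 % 6 + 1),
        (-1 : ℤ) ^ k * ((p / 3 % 6 + k).choose (2 * k) : ℤ) : ℤ) : ZMod p) := by
  have hprime : p.Prime := Fact.out
  have h3 : ¬ 3 ∣ p := fun h => by
    have := (Nat.prime_dvd_prime_iff_eq Nat.prime_three hprime).1 h
    lia
  have h27 : (27 : ZMod p) ≠ 0 := by
    have h : ((3 : ℕ) : ZMod p) ≠ 0 := by
      rw [Ne, ZMod.natCast_eq_zero_iff]
      exact Nat.not_dvd_of_pos_of_lt (by norm_num) hp
    have := pow_ne_zero 3 h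
    norm_num at this
    exact this
  have hroot : 9 * ((p / 3 : ℕ) : ZMod p) ^ 2 + 9 * (p / 3 : ℕ) + 2 = 0 := by
    have hcase : 3 * (p / 3) + 1 = p ∨ 3 * (p / 3) + 2 = p := by lia
    rcases hcase with h | h <;>
    · have h := congrArg (Nat.cast (R := ZMod p)) h
      push_cast [CharP.cast_eq_zero] at h
      first
      | linear_combination (3 * ((p / 3 : ℕ) : ZMod p) + 2) * h
      | linear_combination (3 * ((p / 3 : ℕ) : ZMod p) + 1) * h
  rw [← sum_alternating_choose_even_eq_mod_six]
  push_cast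
  refine sum_congr rfl fun k hk => ?_
  rw [choose_three_mul_eq_of_quadratic (by lia) hroot (by simpa [Nat.lt_succ_iff] using hk),
    mul_div_cancel_left₀ _ (pow_ne_zero k h27)]

theorem stmt13 (p : ℕ) [Fact p.Prime] (hp : 3 < p) :
    (p % 9 = 1 ∨ p % 9 = 8 →
      (∑ k ∈ Finset.range (p / 3 + 1),
          (Nat.choose (3 * k) k : ZMod p) / 27 ^ k) = 1) ∧
    (p % 9 = 2 ∨ p % 9 = 7 →
      (∑ k ∈ Finset.range (p / 3 + 1),
          (Nat.choose (3 * k) k : ZMod p) / 27 ^ k) = -1) ∧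
    (p % 9 = 4 ∨ p % 9 = 5 →
      (∑ k ∈ Finset.range (p / 3 + 1),
          (Nat.choose (3 * k) k : ZMod p) / 27 ^ k) = 0) := by
  have hodd : p % 2 = 1 := by
    have hprime : p.Prime := Fact.out
    rcases hprime.eq_two_or_odd with h | h <;> lia
  rw [sum_choose_three_mul_div_pow hp]
  refine ⟨fun h => ?_, fun h => ?_, fun h => ?_⟩
  · have h6 : p / 3 % 6 = 0 ∨ p / 3 % 6 = 5 := by lia
    rcases h6 with h6 | h6 <;> rw [h6] <;> simp [Finset.sum_range_succ, Nat.choose]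
  · have h6 : p / 3 % 6 = 2 ∨ p / 3 % 6 = 3 := by lia
    rcases h6 with h6 | h6 <;> rw [h6] <;> simp [Finset.sum_range_succ, Nat.choose]
  · have h6 : p / 3 % 6 = 1 ∨ p / 3 % 6 = 4 := by lia
    rcases h6 with h6 | h6 <;> rw [h6] <;> simp [Finset.sum_range_succ, Nat.choose]
end
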